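/- Let θ be a theta function for q, let x ∈ ℂ^g be a point with 2x ∈ Γ and i·x − x ∈ Γ, and let α ∈ A_i be the class of 2x in A₂ = Γ/2Γ. Let m be the order of vanishing of θ at x, i.e. the smallest natural number n such that the n-th iterated derivative of θ at x is nonzero (it exists since θ is analytic and not identically zero). Then i^m · i^{Q_q(α)} = (1 − i)^{−g} · ∑_{β ∈ A_i} i^{Q_q(β)} in ℂ (where i^{c} for c ∈ ℤ/4ℤ denotes i^n for any representative n of c). Equivalently, writing the Gauss sum as 2^{g/2}·e^{iπσ/4} with σ ∈ ℤ/8ℤ the Brown invariant of Q_q, one has 2m ≡ σ + g − 2Q_q(α) (mod 8). -/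

import Mathlib

/-- The embedding `F₂ ≅ 2ℤ/4ℤ ⊂ ℤ/4ℤ`. -/
def emb2 (t : ZMod 2) : ZMod 4 := 2 * t.val

/-- `i^c ∈ ℂ` for `c ∈ ℤ/4ℤ` (equal to `i^n` for any representative `n` of `c`). -/
noncomputable def iPow (c : ZMod 4) : ℂ := Complex.I ^ c.val

/-- The standard Hermitian inner product `H(x, y) = ∑_j conj(x_j)·y_j` on `ℂ^g`. -/
noncomputable def Hform (g : ℕ) (x y : Fin g → ℂ) : ℂ :=
  ∑ j, (starRingEnd ℂ) (x j) * y j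

/-- `ε := id + ī`, an `F₂`-linear endomorphism of `A₂`. -/
def eps {A : Type*} [AddCommGroup A] [Module (ZMod 2) A]
    (Ibar : A →ₗ[ZMod 2] A) : A →ₗ[ZMod 2] A :=
  LinearMap.id + Ibar

/-- `A_i := ε(A₂)`. -/
def Asub {A : Type*} [AddCommGroup A] [Module (ZMod 2) A]
    (Ibar : A →ₗ[ZMod 2] A) : Submodule (ZMod 2) A :=
  LinearMap.range (eps Ibar)

section PartHelper1
open MeasureTheory

noncomputable def nsq {g : ℕ} (z : Fin g → ℂ) : ℝ := ∑ j, ‖z j‖ ^ 2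

section Hlemmas
variable {g : ℕ}

lemma Hform_add_left (x y z : Fin g → ℂ) : Hform g (x + y) z = Hform g x z + Hform g y z := by
  simp [Hform, add_mul, Finset.sum_add_distrib]
lemma Hform_add_right (x y z : Fin g → ℂ) : Hform g z (x + y) = Hform g z x + Hform g z y := by
  simp [Hform, mul_add, Finset.sum_add_distrib]
lemma Hform_sub_left (x y z : Fin g → ℂ) : Hform g (x - y) z = Hform g x z - Hform g y z := by
  simp [Hform, sub_mul, Finset.sum_sub_distrib]
lemma Hform_sub_right (x y z : Fin g → ℂ) : Hform g z (x - y) = Hform g z x - Hform g z y := by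
  simp [Hform, mul_sub, Finset.sum_sub_distrib]
lemma Hform_neg_left (x z : Fin g → ℂ) : Hform g (-x) z = - Hform g x z := by
  simp [Hform]
lemma Hform_neg_right (x z : Fin g → ℂ) : Hform g z (-x) = - Hform g z x := by
  simp [Hform]
lemma Hform_smul_left (c : ℂ) (x z : Fin g → ℂ) :
    Hform g (c • x) z = (starRingEnd ℂ) c * Hform g x z := by
  simp [Hform, Finset.mul_sum, mul_assoc]
lemma Hform_smul_right (c : ℂ) (x z : Fin g → ℂ) : Hform g z (c • x) = c * Hform g z x := by
  simp only [Hform, Finset.mul_sum, Pi.smul_apply, smul_eq_mul]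
  exact Finset.sum_congr rfl fun j _ => by ring
lemma Hform_zero_left (z : Fin g → ℂ) : Hform g 0 z = 0 := by simp [Hform]
lemma Hform_zero_right (z : Fin g → ℂ) : Hform g z 0 = 0 := by simp [Hform]
lemma Hform_conj (x y : Fin g → ℂ) : (starRingEnd ℂ) (Hform g x y) = Hform g y x := by
  simp only [Hform, map_sum, map_mul, Complex.conj_conj]
  exact Finset.sum_congr rfl fun j _ => by ring
lemma Hform_self (x : Fin g → ℂ) : Hform g x x = (nsq x : ℂ) := by
  simp only [Hform, nsq, Complex.ofReal_sum]
  refine Finset.sum_congr rfl fun j _ => ?_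
  rw [mul_comm, Complex.mul_conj, Complex.normSq_eq_norm_sq]
lemma Hform_re_symm (x y : Fin g → ℂ) : (Hform g x y).re = (Hform g y x).re := by
  rw [← Hform_conj]; simp
lemma Hform_im_symm (x y : Fin g → ℂ) : (Hform g x y).im = - (Hform g y x).im := by
  rw [← Hform_conj]; simp
lemma nsq_nonneg (x : Fin g → ℂ) : 0 ≤ nsq x := Finset.sum_nonneg fun _ _ => by positivity
lemma nsq_eq (x : Fin g → ℂ) : nsq x = (Hform g x x).re := by rw [Hform_self]; simp
lemma nsq_add (x y : Fin g → ℂ) : nsq (x + y) = nsq x + nsq y + 2 * (Hform g x y).re := by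
  simp only [nsq_eq, Hform_add_left, Hform_add_right, Complex.add_re]
  rw [Hform_re_symm y x]; ring
lemma nsq_neg (x : Fin g → ℂ) : nsq (-x) = nsq x := by simp [nsq]
lemma nsq_smul (c : ℂ) (x : Fin g → ℂ) : nsq (c • x) = ‖c‖ ^ 2 * nsq x := by
  simp [nsq, Finset.mul_sum, mul_pow]
lemma nsq_sub (x y : Fin g → ℂ) : nsq (x - y) = nsq x + nsq y - 2 * (Hform g x y).re := by
  rw [sub_eq_add_neg, nsq_add, nsq_neg, Hform_neg_right]; simp; ring
lemma nsq_eq_zero {x : Fin g → ℂ} (h : nsq x = 0) : x = 0 := by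
  rw [nsq, Finset.sum_eq_zero_iff_of_nonneg (fun _ _ => by positivity)] at h
  ext j; simpa using h j
lemma norm_sq_le_nsq (x : Fin g → ℂ) : ‖x‖ ^ 2 ≤ nsq x := by
  have h0 := nsq_nonneg x
  have : ‖x‖ ≤ √(nsq x) := by
    rw [pi_norm_le_iff_of_nonneg (Real.sqrt_nonneg _)]
    intro j
    apply Real.le_sqrt_of_sq_le
    exact Finset.single_le_sum (f := fun j => ‖x j‖ ^ 2) (fun _ _ => by positivity) (Finset.mem_univ j)
  calc ‖x‖ ^ 2 ≤ √(nsq x) ^ 2 := by gcongr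
    _ = _ := Real.sq_sqrt h0
/-- a half-bound used for summability -/
lemma nsq_half_le (x y : Fin g → ℂ) : nsq y / 2 ≤ nsq (x - y) + nsq x := by
  have h := nsq_nonneg (x + (x - y))
  rw [nsq_add] at h
  have h2 := nsq_sub x (x - y)
  rw [sub_sub_cancel] at h2
  linarith
lemma continuous_nsq : Continuous (nsq : (Fin g → ℂ) → ℝ) := by unfold nsq; fun_prop
lemma continuous_Hform {X : Type*} [TopologicalSpace X] {f h : X → (Fin g → ℂ)}
    (hf : Continuous f) (hh : Continuous h) : Continuous fun x => Hform g (f x) (h x) := by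
  unfold Hform
  refine continuous_finsetSum _ fun j _ => ?_
  exact (Complex.continuous_conj.comp ((continuous_apply j).comp hf)).mul
    ((continuous_apply j).comp hh)
lemma contDiff_Hform (x : Fin g → ℂ) {n : WithTop ℕ∞} : ContDiff ℂ n fun z => Hform g x z := by
  unfold Hform; fun_prop
end Hlemmas

section Gauss
variable {g : ℕ}

lemma gauss_integrable {b : ℂ} (hb : 0 < b.re) :
    Integrable fun w : Fin g → ℂ => Complex.exp (-b * (nsq w : ℂ)) := by
  have : (fun w : Fin g → ℂ => Complex.exp (-b * (nsq w : ℂ))) =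
      fun w => ∏ j, Complex.exp (-b * (‖w j‖ : ℂ) ^ 2) := by
    ext w; rw [← Complex.exp_sum, ← Finset.mul_sum]; simp [nsq]
  rw [this]
  refine Integrable.fintype_prod (f := fun _ z => Complex.exp (-b * (‖z‖ : ℂ) ^ 2)) (fun _ => ?_)
  simpa using GaussianFourier.integrable_cexp_neg_mul_sq_norm_add hb 0 (0 : ℂ)

lemma gauss_integral {b : ℂ} (hb : 0 < b.re) :
    ∫ w : Fin g → ℂ, Complex.exp (-b * (nsq w : ℂ)) = (Real.pi / b) ^ g := by
  have : (fun w : Fin g → ℂ => Complex.exp (-b * (nsq w : ℂ))) =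
      fun w => ∏ j, Complex.exp (-b * (‖w j‖ : ℂ) ^ 2) := by
    ext w; rw [← Complex.exp_sum, ← Finset.mul_sum]; simp [nsq]
  rw [this, integral_fintype_prod_volume_eq_pow (fun z : ℂ => Complex.exp (-b * (‖z‖ : ℂ) ^ 2)),
    GaussianFourier.integral_cexp_neg_mul_sq_norm hb]
  simp

lemma rgauss_integrable {b : ℝ} (hb : 0 < b) :
    Integrable fun w : Fin g → ℂ => Real.exp (-b * nsq w) := by
  have := (gauss_integrable (g := g) (b := b) (by simpa using hb)).norm
  refine this.congr (Filter.Eventually.of_forall fun w => ?_)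
  simp [Complex.norm_exp]

lemma rot_mp (t : ℝ) : MeasurePreserving
    (fun w : Fin g → ℂ => (Circle.exp t : ℂ) • w) volume volume := by
  have := volume_preserving_pi (fun _ : Fin g => (rotation (Circle.exp t)).measurePreserving)
  convert! this using 1

/-- mean value property, Gaussian version -/
lemma gauss_mean {h : (Fin g → ℂ) → ℂ} (hd : Differentiable ℂ h) {C : ℝ}
    (hC : ∀ w, ‖h w‖ ≤ C * Real.exp (Real.pi / 2 * nsq w)) :
    ∫ w, h w * Complex.exp (-(Real.pi : ℂ) * nsq w) = h 0 := by
  set I := ∫ w, h w * Complex.exp (-(Real.pi : ℂ) * nsq w) with hI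
  let F : ℝ → (Fin g → ℂ) → ℂ := fun t w =>
    h ((Circle.exp t : ℂ) • w) * Complex.exp (-(Real.pi : ℂ) * nsq w)
  have hcont : Continuous (Function.uncurry F) := by
    have h1 := hd.continuous
    have h2 := continuous_nsq (g := g)
    simp only [Function.uncurry_def, F]
    fun_prop
  have hbd : ∀ t w, ‖F t w‖ ≤ C * Real.exp (-(Real.pi / 2) * nsq w) := by
    intro t w
    have := hC ((Circle.exp t : ℂ) • w)
    rw [nsq_smul] at this
    simp only [Circle.norm_coe, one_pow, one_mul] at this
    simp only [F, norm_mul, Complex.norm_exp]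
    calc _ ≤ C * Real.exp (Real.pi / 2 * nsq w) * Real.exp (-Real.pi * nsq w) := by
          refine mul_le_mul this (le_of_eq ?_) (by positivity) (le_trans (norm_nonneg _) this)
          congr 1
          simp
      _ = _ := by rw [mul_assoc, ← Real.exp_add]; ring_nf
  have hFint : Integrable (Function.uncurry F)
      ((volume.restrict (Set.uIoc 0 (2 * Real.pi))).prod volume) := by
    have hb : Integrable (fun p : ℝ × (Fin g → ℂ) => (1 : ℝ) * (C * Real.exp (-(Real.pi / 2) * nsq p.2)))
        ((volume.restrict (Set.uIoc 0 (2 * Real.pi))).prod volume) := by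
      have hA : Integrable (fun _ : ℝ => (1 : ℝ)) (volume.restrict (Set.uIoc 0 (2 * Real.pi))) := by
        rw [Set.uIoc_of_le (by positivity)]
        exact integrable_const _
      exact hA.mul_prod ((rgauss_integrable (g := g) (b := Real.pi / 2) (by positivity)).const_mul C)
    refine hb.mono' hcont.aestronglyMeasurable (Filter.Eventually.of_forall fun p => ?_)
    rw [one_mul]
    exact hbd p.1 p.2
  have h1 : ∀ t, ∫ w, F t w = I := by
    intro t
    have := (rot_mp (g := g) t).integral_comp' (f := (Homeomorph.smulOfNeZero (Circle.exp t : ℂ) (by simp)).toMeasurableEquiv)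
      (g := fun w => h w * Complex.exp (-(Real.pi : ℂ) * nsq w))
    rw [hI, ← this]
    congr 1
    ext w
    simp [F, nsq_smul]
  have h2 : ∫ t in (0)..(2 * Real.pi), ∫ w, F t w = (2 * Real.pi : ℝ) • I := by
    simp [h1]
  rw [intervalIntegral_integral_swap hFint] at h2
  have h3 : ∀ w, ∫ t in (0)..(2 * Real.pi), F t w =
      (2 * Real.pi * h 0) * Complex.exp (-(Real.pi : ℂ) * nsq w) := by
    intro w
    simp only [F]
    rw [intervalIntegral.integral_mul_const]
    congr 1
    have hdw : Differentiable ℂ fun s : ℂ => h (s • w) := by fun_prop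
    have := DiffContOnCl.circleAverage (f := fun s : ℂ => h (s • w)) (c := 0) (R := 1)
      hdw.diffContOnCl
    rw [Real.circleAverage_def] at this
    simp only [zero_smul] at this
    rw [← this]
    simp [circleMap]
    field_simp
    simp_rw [mul_comm Complex.I]
  simp_rw [h3] at h2
  rw [integral_const_mul, gauss_integral (by simpa using Real.pi_pos)] at h2
  have hpi : (Real.pi : ℂ) ≠ 0 := by simp [Real.pi_ne_zero]
  rw [div_self hpi] at h2
  simp at h2
  exact h2.symm

/-- the normalized Fock kernel -/
noncomputable def fk (z w : Fin g → ℂ) : ℂ :=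
  Complex.exp (Real.pi * (Hform g w z - Hform g z z / 2 - Hform g w w / 2))

lemma norm_fk (z w : Fin g → ℂ) : ‖fk z w‖ = Real.exp (-(Real.pi / 2) * nsq (z - w)) := by
  rw [fk, Complex.norm_exp]
  congr 1
  rw [nsq_sub, nsq_eq z, nsq_eq w, Hform_re_symm z w]
  simp [Hform_self]
  ring

lemma continuous_fk : Continuous fun p : (Fin g → ℂ) × (Fin g → ℂ) => fk p.1 p.2 := by
  unfold fk
  have h1 := continuous_Hform (g := g) (continuous_snd (X := Fin g → ℂ)) (continuous_fst (Y := Fin g → ℂ))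
  have h2 := continuous_Hform (g := g) (continuous_fst (X := Fin g → ℂ) (Y := Fin g → ℂ)) continuous_fst
  have h3 := continuous_Hform (g := g) (continuous_snd (X := Fin g → ℂ) (Y := Fin g → ℂ)) continuous_snd
  fun_prop

/-- normalized function attached to an entire function -/
noncomputable def nf (h : (Fin g → ℂ) → ℂ) (z : Fin g → ℂ) : ℂ :=
  h z * Complex.exp (-(Real.pi / 2 : ℂ) * Hform g z z)

lemma nf_def (h : (Fin g → ℂ) → ℂ) : nf h = fun z =>
    h z * Complex.exp (-(Real.pi / 2 : ℂ) * Hform g z z) := rfl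

lemma norm_nf (h : (Fin g → ℂ) → ℂ) (z : Fin g → ℂ) :
    ‖nf h z‖ = ‖h z‖ * Real.exp (-(Real.pi / 2) * nsq z) := by
  rw [nf, norm_mul, Complex.norm_exp, Hform_self]
  congr 2
  rw [Complex.re_mul_ofReal]; simp

lemma fk_repro {h : (Fin g → ℂ) → ℂ} (hd : Differentiable ℂ h) {C : ℝ}
    (hC : ∀ w, ‖nf h w‖ ≤ C) (z : Fin g → ℂ) :
    ∫ w, fk z w * nf h w = nf h z := by
  let h' : (Fin g → ℂ) → ℂ := fun u => h (z + u) * Complex.exp (-(Real.pi : ℂ) * Hform g z u)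
  have hd' : Differentiable ℂ h' := by
    have := (contDiff_Hform (g := g) z (n := 1)).differentiable (by simp)
    simp only [h']
    fun_prop
  have hC' : ∀ u, ‖h' u‖ ≤ (C * Real.exp (Real.pi / 2 * nsq z)) * Real.exp (Real.pi / 2 * nsq u) := by
    intro u
    have := hC (z + u)
    rw [norm_nf, nsq_add] at this
    have h2 : ‖h' u‖ = ‖h (z + u)‖ * Real.exp (-(Real.pi / 2) * (nsq z + nsq u + 2 * (Hform g z u).re))
        * (Real.exp (Real.pi / 2 * nsq z) * Real.exp (Real.pi / 2 * nsq u)) := by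
      simp only [h', norm_mul, Complex.norm_exp]
      rw [mul_assoc, ← Real.exp_add, ← Real.exp_add]
      congr 2
      simp; ring
    rw [h2, mul_assoc C]
    gcongr
  have key := gauss_mean hd' hC'
  have h0 : h' 0 = h z := by simp [h', Hform_zero_right]
  rw [h0] at key
  rw [← integral_add_left_eq_self _ z]
  rw [nf, ← key, ← integral_mul_const]
  congr 1
  ext u
  simp only [h', fk, nf, ← Hform_self, Hform_add_left, Hform_add_right]
  rw [mul_left_comm, ← Complex.exp_add, mul_assoc, mul_assoc, ← Complex.exp_add, ← Complex.exp_add]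
  congr 2
  ring
end Gauss

end PartHelper1

section PartHelper2
open MeasureTheory
section Osgood
variable {g : ℕ}
lemma fderiv_bound {f : (Fin g → ℂ) → ℂ} (hf : Differentiable ℂ f) (R : ℝ) :
    ∃ C, 0 ≤ C ∧ ∀ z, ‖z‖ ≤ R → ‖fderiv ℂ f z‖ ≤ C := by
  obtain ⟨M, hM⟩ := (isCompact_closedBall (0 : Fin g → ℂ) (R + 1)).exists_bound_of_continuousOn
    hf.continuous.continuousOn
  refine ⟨max M 0, le_max_right _ _, fun z hz => ?_⟩
  refine ContinuousLinearMap.opNorm_le_bound _ (le_max_right _ _) fun u => ?_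
  rcases eq_or_ne u 0 with rfl | hu
  · simp
  have hu' : 0 < ‖u‖ := norm_pos_iff.mpr hu
  have hder : HasDerivAt (fun s : ℂ => f (z + s • u)) (fderiv ℂ f z u) 0 := by
    have h1 : HasDerivAt (fun s : ℂ => z + s • u) u 0 := by
      simpa using ((hasDerivAt_id (0 : ℂ)).smul_const u).const_add z
    have h2 : HasFDerivAt f (fderiv ℂ f z) (z + (0 : ℂ) • u) := by
      simpa using (hf z).hasFDerivAt
    exact h2.comp_hasDerivAt 0 h1
  rw [← hder.deriv]
  have := Complex.norm_deriv_le_of_forall_mem_sphere_norm_le (c := 0) (R := 1 / ‖u‖)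
    (f := fun s : ℂ => f (z + s • u)) (C := max M 0) (by positivity)
    (by
      have : Differentiable ℂ (fun s : ℂ => f (z + s • u)) := by fun_prop
      exact this.diffContOnCl)
    (by
      intro s hs
      refine (hM _ ?_).trans (le_max_left _ _)
      rw [mem_closedBall_zero_iff]
      refine (norm_add_le _ _).trans ?_
      rw [mem_sphere_zero_iff_norm] at hs
      rw [norm_smul, hs]
      have : 1 / ‖u‖ * ‖u‖ = 1 := by field_simp
      linarith)
  simpa using this

lemma fderiv_apply_differentiable {f : (Fin g → ℂ) → ℂ} (hf : Differentiable ℂ f) (v : Fin g → ℂ) :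
    Differentiable ℂ fun z => fderiv ℂ f z v := by
  have hrep : ∀ z, fderiv ℂ f z v = (2 * Real.pi * Complex.I : ℂ)⁻¹ *
      ∫ τ in (0)..(2 * Real.pi), (deriv (circleMap 0 1) τ * ((circleMap 0 1 τ) ^ 2)⁻¹) *
        f (z + circleMap 0 1 τ • v) := by
    intro z
    have hder : HasDerivAt (fun s : ℂ => f (z + s • v)) (fderiv ℂ f z v) 0 := by
      have h1 : HasDerivAt (fun s : ℂ => z + s • v) v 0 := by
        simpa using ((hasDerivAt_id (0 : ℂ)).smul_const v).const_add z
      have h2 : HasFDerivAt f (fderiv ℂ f z) (z + (0 : ℂ) • v) := by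
        simpa using (hf z).hasFDerivAt
      exact h2.comp_hasDerivAt 0 h1
    have hd : Differentiable ℂ (fun s : ℂ => f (z + s • v)) := by fun_prop
    rw [← hder.deriv, ← Complex.two_pi_I_inv_smul_circleIntegral_sub_sq_inv_smul_of_differentiable
      (R := 1) (c := 0) isOpen_univ (Set.subset_univ _) hd.differentiableOn (by simp)]
    rw [circleIntegral, smul_eq_mul]
    congr 1
    refine intervalIntegral.integral_congr fun τ _ => ?_
    simp [mul_assoc]
  have hrep' : (fun z => fderiv ℂ f z v) = _ := funext hrep
  rw [hrep']
  refine Differentiable.const_mul (fun z₀ => ?_) _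
  obtain ⟨C, hC0, hC⟩ := fderiv_bound hf (‖z₀‖ + 1 + ‖v‖)
  have hfc := hf.continuous
  have hcm : Continuous (circleMap 0 1) := continuous_circleMap 0 1
  have hco : Continuous fun τ => (deriv (circleMap 0 1) τ * ((circleMap 0 1 τ) ^ 2)⁻¹) := by
    simp only [deriv_circleMap]
    refine Continuous.mul (by fun_prop) (Continuous.inv₀ (by fun_prop) fun τ => ?_)
    simp [circleMap]
  have hno : ∀ τ, ‖(deriv (circleMap 0 1) τ * ((circleMap 0 1 τ) ^ 2)⁻¹)‖ = 1 := by
    intro τ; simp [deriv_circleMap]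
  have key := intervalIntegral.hasFDerivAt_integral_of_dominated_of_fderiv_le
    (𝕜 := ℂ) (μ := volume) (a := 0) (b := 2 * Real.pi)
    (F := fun z τ => (deriv (circleMap 0 1) τ * ((circleMap 0 1 τ) ^ 2)⁻¹) *
        f (z + circleMap 0 1 τ • v))
    (F' := fun z τ => (deriv (circleMap 0 1) τ * ((circleMap 0 1 τ) ^ 2)⁻¹) •
        fderiv ℂ f (z + circleMap 0 1 τ • v))
    (x₀ := z₀) (s := Metric.ball z₀ 1) (bound := fun _ => C) (Metric.ball_mem_nhds _ one_pos)
    (Filter.Eventually.of_forall fun z => by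
      apply Continuous.aestronglyMeasurable; fun_prop)
    (by apply Continuous.intervalIntegrable; fun_prop)
    (by
      have : Measurable (fderiv ℂ f) := measurable_fderiv ℂ f
      have h2 : Measurable fun τ : ℝ => fderiv ℂ f (z₀ + circleMap 0 1 τ • v) :=
        this.comp (by apply Continuous.measurable; fun_prop)
      exact (hco.aestronglyMeasurable.smul h2.aestronglyMeasurable))
    (Filter.Eventually.of_forall fun τ _ z hz => by
      rw [norm_smul, hno, one_mul]
      refine hC _ ?_
      have h1 : ‖z‖ ≤ ‖z₀‖ + 1 := by
        rw [mem_ball_iff_norm] at hz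
        have := norm_le_norm_add_norm_sub' z z₀
        linarith
      refine (norm_add_le _ _).trans ?_
      rw [norm_smul]
      simp
      linarith)
    (by simp)
    (Filter.Eventually.of_forall fun τ _ z hz => by
      have h1 : HasFDerivAt (fun z => f (z + circleMap 0 1 τ • v))
          (fderiv ℂ f (z + circleMap 0 1 τ • v)) z := by
        have := (hf (z + circleMap 0 1 τ • v)).hasFDerivAt
        have h3 : HasFDerivAt (fun z => z + circleMap 0 1 τ • v) (ContinuousLinearMap.id ℂ _) z :=
          (hasFDerivAt_id z).add_const _
        exact this.comp z h3
      exact h1.const_mul _)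
  exact key.differentiableAt

lemma contDiff_of_differentiable (n : ℕ) : ∀ {f : (Fin g → ℂ) → ℂ}, Differentiable ℂ f →
    ContDiff ℂ n f := by
  induction n with
  | zero => intro f hf; exact_mod_cast contDiff_zero.mpr hf.continuous
  | succ n ih =>
    intro f hf
    push_cast
    rw [contDiff_succ_iff_fderiv_apply]
    exact ⟨hf, by simp, fun y => ih (fderiv_apply_differentiable hf y)⟩

/-- leading-term comparison -/
lemma order_compare {θ e : (Fin g → ℂ) → ℂ} (hθ : Differentiable ℂ θ) (he : Differentiable ℂ e)
    (x : Fin g → ℂ) (c : ℂ) (h : ∀ z, e z * θ (x + Complex.I • z) = c * θ (x + z))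
    (m : ℕ) (hm : iteratedFDeriv ℂ m θ x ≠ 0) (hmin : ∀ k < m, iteratedFDeriv ℂ k θ x = 0) :
    e 0 * Complex.I ^ m = c := by
  let φ : (Fin g → ℂ) → ℂ := fun z => θ (x + z)
  have hφ : Differentiable ℂ φ := by simp only [φ]; fun_prop
  have hφk : ∀ k, iteratedFDeriv ℂ k φ 0 = iteratedFDeriv ℂ k θ x := by
    intro k
    simp only [φ]
    rw [iteratedFDeriv_comp_add_left]; simp
  let L : (Fin g → ℂ) →L[ℂ] (Fin g → ℂ) := Complex.I • ContinuousLinearMap.id ℂ _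
  have hψ : Differentiable ℂ (φ ∘ L) := hφ.comp L.differentiable
  have hψk : ∀ k, iteratedFDeriv ℂ k (φ ∘ L) 0 = Complex.I ^ k • iteratedFDeriv ℂ k φ 0 := by
    intro k
    rw [ContinuousLinearMap.iteratedFDeriv_comp_right L (contDiff_of_differentiable k hφ) 0 le_rfl]
    ext v
    simp only [ContinuousMultilinearMap.compContinuousLinearMap_apply, map_zero,
      smul_apply]
    have := (iteratedFDeriv ℂ k φ 0).map_smul_univ (fun _ => Complex.I) v
    simpa [L] using this
  have hsplit : (fun z => c * φ z) = (fun z => e 0 * (φ ∘ L) z) + fun z => (e z - e 0) * (φ ∘ L) z := by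
    ext z
    simp only [Pi.add_apply]
    rw [← add_mul, add_sub_cancel]
    exact (h z).symm
  have h1 : iteratedFDeriv ℂ m (fun z => c * φ z) 0 = c • iteratedFDeriv ℂ m φ 0 := by
    have := iteratedFDeriv_const_smul_apply (𝕜 := ℂ) (a := c) (x := (0 : Fin g → ℂ))
      (contDiff_of_differentiable m hφ).contDiffAt
    exact this
  have hrest : iteratedFDeriv ℂ m (fun z => (e z - e 0) * (φ ∘ L) z) 0 = 0 := by
    have he' : Differentiable ℂ fun z => e z - e 0 := by fun_prop
    have hb := norm_iteratedFDeriv_mul_le (contDiff_of_differentiable m he')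
      (contDiff_of_differentiable m hψ) 0 (n := m) le_rfl
    rw [Finset.sum_eq_zero] at hb
    · simpa using hb
    intro i hi
    rcases Nat.eq_zero_or_pos i with rfl | hi0
    · simp
    · have : m - i < m := by
        have := Finset.mem_range.mp hi
        omega
      rw [hψk, hφk, hmin _ this]; simp
  have h2 : iteratedFDeriv ℂ m (fun z => e 0 * (φ ∘ L) z) 0 = e 0 • iteratedFDeriv ℂ m (φ ∘ L) 0 := by
    have := iteratedFDeriv_const_smul_apply (𝕜 := ℂ) (a := e 0) (x := (0 : Fin g → ℂ))
      (contDiff_of_differentiable m hψ).contDiffAt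
    exact this
  have h3 := congrArg (fun F => iteratedFDeriv ℂ m F 0) hsplit
  rw [iteratedFDeriv_add_apply, hrest, h2, h1, hψk, hφk, add_zero, smul_smul] at h3
  · exact (smul_left_injective ℂ hm h3).symm
  · exact (contDiff_of_differentiable m (hψ.const_mul _)).contDiffAt
  · exact (contDiff_of_differentiable m (by fun_prop)).contDiffAt
end Osgood

end PartHelper2

section PartHelper3
open MeasureTheory
section Lat
open scoped Pointwise
variable {g : ℕ} {Γ : AddSubgroup (Fin g → ℂ)} {D : Set (Fin g → ℂ)} {a : Γ → ℂ}

structure LatData (Γ : AddSubgroup (Fin g → ℂ)) (D : Set (Fin g → ℂ)) (a : Γ → ℂ) : Prop where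
  countable : Countable Γ
  fd : IsAddFundamentalDomain Γ D volume
  bdd : Bornology.IsBounded D
  vol : volume D = 1
  cover : ∀ z, ∃ γ : Γ, ∃ w ∈ D, z = w + γ
  summ : ∀ t : ℝ, 0 < t → Summable fun γ : Γ => Real.exp (-t * nsq (γ : Fin g → ℂ))
  a_pm : ∀ γ, a γ = 1 ∨ a γ = -1
  a_sub : ∀ γ δ : Γ, a (γ - δ) = a γ * a δ *
    Complex.exp (Real.pi / 2 * (Hform g δ γ - Hform g γ δ))

noncomputable def chi (a : Γ → ℂ) (γ : Γ) (w : Fin g → ℂ) : ℂ :=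
  a γ * Complex.exp (Real.pi / 2 * (Hform g γ w - Hform g w γ))

noncomputable def TT (a : Γ → ℂ) (γ : Γ) (z w : Fin g → ℂ) : ℂ := fk z (w + γ) * chi a γ w

noncomputable def KK (a : Γ → ℂ) (z w : Fin g → ℂ) : ℂ := ∑' γ : Γ, TT a γ z w

namespace LatData

lemma norm_a (L : LatData Γ D a) (γ : Γ) : ‖a γ‖ = 1 := by
  rcases L.a_pm γ with h | h <;> simp [h]

lemma conj_a (L : LatData Γ D a) (γ : Γ) : (starRingEnd ℂ) (a γ) = a γ := by
  rcases L.a_pm γ with h | h <;> simp [h]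

lemma a_mul_a (L : LatData Γ D a) (γ : Γ) : a γ * a γ = 1 := by
  rcases L.a_pm γ with h | h <;> simp [h]

lemma a_zero (L : LatData Γ D a) : a 0 = 1 := by
  have := L.a_sub 0 0
  simp [Hform_zero_left] at this
  rw [this, L.a_mul_a]

lemma e_int (L : LatData Γ D a) (γ δ : Γ) :
    Complex.exp (Real.pi * (Hform g γ δ - Hform g δ γ)) = 1 := by
  have h1 := L.a_sub δ γ
  have h2 := L.a_mul_a (δ - γ)
  rw [h1] at h2
  have h3 : Complex.exp (Real.pi * (Hform g γ δ - Hform g δ γ)) =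
    Complex.exp (Real.pi / 2 * (Hform g γ δ - Hform g δ γ)) *
    Complex.exp (Real.pi / 2 * (Hform g γ δ - Hform g δ γ)) := by
    rw [← Complex.exp_add]; congr 1; ring
  rw [h3]
  have e1 := L.a_mul_a δ
  have e2 := L.a_mul_a γ
  linear_combination h2 - (Complex.exp (Real.pi / 2 * (Hform g γ δ - Hform g δ γ))) ^ 2 *
    (a γ * a γ * e1 + e2)

lemma conj_chi_eq (L : LatData Γ D a) (γ : Γ) (w : Fin g → ℂ) :
    (starRingEnd ℂ) (chi a γ w) =
      a γ * Complex.exp (-(Real.pi / 2 * (Hform g γ w - Hform g w γ))) := by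
  rw [chi, map_mul, L.conj_a, ← Complex.exp_conj]
  congr 2
  simp only [map_mul, map_sub, map_div₀, Complex.conj_ofReal, Hform_conj, map_ofNat]
  ring

lemma conj_chi_mul (L : LatData Γ D a) (γ : Γ) (w : Fin g → ℂ) :
    (starRingEnd ℂ) (chi a γ w) * chi a γ w = 1 := by
  rw [L.conj_chi_eq, chi, mul_mul_mul_comm, L.a_mul_a, ← Complex.exp_add]; simp

lemma norm_chi (L : LatData Γ D a) (γ : Γ) (w : Fin g → ℂ) : ‖chi a γ w‖ = 1 := by
  have := congrArg norm (L.conj_chi_mul γ w)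
  rw [norm_mul, Complex.norm_conj] at this
  simp at this
  nlinarith [norm_nonneg (chi a γ w)]

lemma norm_TT (L : LatData Γ D a) (γ : Γ) (z w : Fin g → ℂ) :
    ‖TT a γ z w‖ = Real.exp (-(Real.pi / 2) * nsq (z - w - (γ : Fin g → ℂ))) := by
  rw [TT, norm_mul, L.norm_chi, norm_fk, mul_one, sub_sub]

lemma norm_TT_le (L : LatData Γ D a) (γ : Γ) (z w : Fin g → ℂ) :
    ‖TT a γ z w‖ ≤ Real.exp (Real.pi / 2 * nsq (z - w)) *
      Real.exp (-(Real.pi / 4) * nsq (γ : Fin g → ℂ)) := by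
  rw [L.norm_TT, ← Real.exp_add]
  gcongr
  have := nsq_half_le (z - w) γ
  nlinarith [Real.pi_pos]

lemma continuous_TT (γ : Γ) :
    Continuous fun p : (Fin g → ℂ) × (Fin g → ℂ) => TT a γ p.1 p.2 := by
  unfold TT chi
  have h1 := continuous_Hform (g := g) (continuous_const (y := (γ : Fin g → ℂ))
    (X := (Fin g → ℂ) × (Fin g → ℂ))) continuous_snd
  have h2 := continuous_Hform (g := g) (X := (Fin g → ℂ) × (Fin g → ℂ)) continuous_snd
    (continuous_const (y := (γ : Fin g → ℂ)))
  have h3 : Continuous fun p : (Fin g → ℂ) × (Fin g → ℂ) => fk p.1 (p.2 + γ) :=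
    continuous_fk.comp (f := fun p : (Fin g → ℂ) × (Fin g → ℂ) => (p.1, p.2 + (γ : Fin g → ℂ)))
      (by fun_prop)
  fun_prop

lemma summable_TT (L : LatData Γ D a) (z w : Fin g → ℂ) : Summable fun γ => TT a γ z w :=
  Summable.of_norm_bounded ((L.summ (Real.pi / 4) (by positivity)).mul_left _)
    fun γ => L.norm_TT_le γ z w

lemma continuous_KK (L : LatData Γ D a) :
    Continuous fun p : (Fin g → ℂ) × (Fin g → ℂ) => KK a p.1 p.2 := by
  have h1 : Continuous fun p : (Fin g → ℂ) × (Fin g → ℂ) =>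
      ∑' γ : Γ, Complex.exp (-(Real.pi / 2 : ℝ) * nsq (p.1 - p.2)) * TT a γ p.1 p.2 := by
    refine continuous_tsum (u := fun γ : Γ => Real.exp (-(Real.pi / 4) * nsq (γ : Fin g → ℂ)))
      (fun γ => ?_) (L.summ _ (by positivity)) fun γ p => ?_
    · have := continuous_TT (a := a) γ
      have h2 := continuous_nsq (g := g)
      fun_prop
    · rw [norm_mul]
      have h2 := L.norm_TT_le γ p.1 p.2
      have h3 : ‖Complex.exp (-(Real.pi / 2 : ℝ) * nsq (p.1 - p.2))‖ =
          Real.exp (-(Real.pi / 2 * nsq (p.1 - p.2))) := by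
        rw [Complex.norm_exp]; congr 1
        rw [Complex.re_mul_ofReal]; simp
      rw [h3, Real.exp_neg]
      have := Real.exp_pos (Real.pi / 2 * nsq (p.1 - p.2))
      rw [inv_mul_le_iff₀ this]
      exact h2
  have h2 : (fun p : (Fin g → ℂ) × (Fin g → ℂ) => KK a p.1 p.2) = fun p =>
      Complex.exp ((Real.pi / 2 : ℝ) * nsq (p.1 - p.2)) *
      ∑' γ : Γ, Complex.exp (-(Real.pi / 2 : ℝ) * nsq (p.1 - p.2)) * TT a γ p.1 p.2 := by
    ext p
    rw [tsum_mul_left, ← mul_assoc, ← Complex.exp_add, KK]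
    simp
  rw [h2]
  have h3 := continuous_nsq (g := g)
  fun_prop

lemma KK_shift (L : LatData Γ D a) (z w : Fin g → ℂ) (δ : Γ) :
    KK a z (w + δ) * chi a δ w = KK a z w := by
  unfold KK
  rw [← tsum_mul_right, ← (Equiv.subRight δ).tsum_eq]
  refine tsum_congr fun γ => ?_
  simp only [Equiv.subRight_apply, TT, chi, L.a_sub]
  have e1 := L.a_mul_a δ
  have : w + (δ : Fin g → ℂ) + ((γ - δ : Γ) : Fin g → ℂ) = w + γ := by push_cast; abel
  rw [this]
  have e2 : Complex.exp (Real.pi / 2 * (Hform g δ γ - Hform g γ δ)) *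
      Complex.exp (Real.pi / 2 * (Hform g ((γ - δ : Γ) : Fin g → ℂ) (w + δ)
        - Hform g (w + δ) ((γ - δ : Γ) : Fin g → ℂ))) *
      Complex.exp (Real.pi / 2 * (Hform g δ w - Hform g w δ)) =
      Complex.exp (Real.pi / 2 * (Hform g γ w - Hform g w γ)) := by
    rw [← Complex.exp_add, ← Complex.exp_add]
    congr 1
    push_cast
    simp only [Hform_add_left, Hform_add_right, Hform_sub_left, Hform_sub_right]
    ring
  rw [← e2]
  linear_combination (fk z (w + γ) * a γ * Complex.exp (Real.pi / 2 * (Hform g δ γ - Hform g γ δ)) *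
      Complex.exp (Real.pi / 2 * (Hform g ((γ - δ : Γ) : Fin g → ℂ) (w + δ)
        - Hform g (w + δ) ((γ - δ : Γ) : Fin g → ℂ))) *
      Complex.exp (Real.pi / 2 * (Hform g δ w - Hform g w δ))) * e1

lemma conj_KK_shift (L : LatData Γ D a) (z w : Fin g → ℂ) (δ : Γ) :
    (starRingEnd ℂ) (KK a z (w + δ)) = chi a δ w * (starRingEnd ℂ) (KK a z w) := by
  rw [← L.KK_shift z w δ, map_mul]
  linear_combination -(starRingEnd ℂ) (KK a z (w + δ)) * L.conj_chi_mul δ w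

lemma bounded_on_D (L : LatData Γ D a) {h : (Fin g → ℂ) → ℂ} (hc : Continuous h) :
    ∃ C, 0 ≤ C ∧ ∀ w ∈ D, ‖h w‖ ≤ C := by
  obtain ⟨C, hC⟩ := L.bdd.isCompact_closure.exists_bound_of_continuousOn hc.continuousOn
  exact ⟨max C 0, le_max_right _ _, fun w hw => (hC w (subset_closure hw)).trans (le_max_left _ _)⟩

lemma bounded_of_chi (L : LatData Γ D a) {h : (Fin g → ℂ) → ℂ} (hc : Continuous h)
    (hh : ∀ (γ : Γ) w, h (w + γ) = chi a γ w * h w) : ∃ C, 0 ≤ C ∧ ∀ w, ‖h w‖ ≤ C := by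
  obtain ⟨C, hC0, hC⟩ := L.bounded_on_D hc
  refine ⟨C, hC0, fun z => ?_⟩
  obtain ⟨γ, w, hw, rfl⟩ := L.cover z
  rw [hh, norm_mul, L.norm_chi, one_mul]
  exact hC w hw

lemma finD (L : LatData Γ D a) : IsFiniteMeasure (volume.restrict D) :=
  ⟨by simp [L.vol]⟩

lemma ae_D (L : LatData Γ D a) : ∀ᵐ w ∂(volume.restrict D), w ∈ D :=
  ae_restrict_mem₀ L.fd.nullMeasurableSet

lemma integrableD (L : LatData Γ D a) {h : (Fin g → ℂ) → ℂ} (hc : Continuous h) :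
    Integrable h (volume.restrict D) := by
  have := L.finD
  obtain ⟨C, hC0, hC⟩ := L.bounded_on_D hc
  exact (integrable_const C).mono' hc.aestronglyMeasurable (L.ae_D.mono fun w hw => hC w hw)

lemma swapD (L : LatData Γ D a) {F : Γ → (Fin g → ℂ) → ℂ} (hF : ∀ γ, Continuous (F γ))
    {C t : ℝ} (ht : 0 < t)
    (hb : ∀ γ : Γ, ∀ w ∈ D, ‖F γ w‖ ≤ C * Real.exp (-t * nsq (γ : Fin g → ℂ))) :
    HasSum (fun γ => ∫ w in D, F γ w) (∫ w in D, ∑' γ, F γ w) := by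
  have := L.finD
  have := L.countable
  refine hasSum_integral_of_summable_integral_norm (fun γ => L.integrableD (hF γ)) ?_
  refine Summable.of_nonneg_of_le (fun γ => integral_nonneg fun _ => norm_nonneg _) (fun γ => ?_)
    ((L.summ t ht).mul_left C)
  calc ∫ w in D, ‖F γ w‖ ≤ ∫ w in D, C * Real.exp (-t * nsq (γ : Fin g → ℂ)) :=
        integral_mono_ae (L.integrableD (hF γ)).norm (integrable_const _)
          (L.ae_D.mono fun w hw => hb γ w hw)
    _ = _ := by simp [measureReal_def, L.vol]

lemma unfoldD (L : LatData Γ D a) {h : (Fin g → ℂ) → ℂ} (hc : Continuous h)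
    (hh : ∀ (γ : Γ) w, h (w + γ) = chi a γ w * h w) (z : Fin g → ℂ) :
    ∫ w in D, KK a z w * h w = ∫ w, fk z w * h w := by
  have := L.countable
  obtain ⟨C, hC0, hC⟩ := L.bounded_of_chi hc hh
  have hfz : Continuous fun w => fk z w :=
    continuous_fk.comp (f := fun w : Fin g → ℂ => (z, w)) (by fun_prop)
  have hint : Integrable fun w => fk z w * h w := by
    have h1 : Integrable fun w : Fin g → ℂ => Real.exp (-(Real.pi / 2) * nsq (z - w)) * C :=
      ((rgauss_integrable (g := g) (b := Real.pi / 2) (by positivity)).comp_sub_left z).mul_const C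
    refine h1.mono' (hfz.mul hc).aestronglyMeasurable (Filter.Eventually.of_forall fun w => ?_)
    rw [norm_mul, norm_fk]
    gcongr
    exact hC w
  rw [L.fd.integral_eq_tsum'' _ hint]
  have h2 : ∀ (γ : Γ) (w : Fin g → ℂ), fk z (γ +ᵥ w) * h (γ +ᵥ w) = TT a γ z w * h w := by
    intro γ w
    have : γ +ᵥ w = w + (γ : Fin g → ℂ) := by rw [AddSubgroup.vadd_def, vadd_eq_add, add_comm]
    rw [this, hh, TT]; ring
  simp_rw [h2]
  obtain ⟨C2, hC20, hC2⟩ := L.bounded_on_D (h := fun w =>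
    Complex.exp ((Real.pi / 2 : ℝ) * nsq (z - w)) * h w) (by
      have h3 := continuous_nsq (g := g)
      fun_prop)
  have := L.swapD (F := fun γ w => TT a γ z w * h w) (C := C2) (t := Real.pi / 4)
    (fun γ => ((continuous_TT γ).comp (f := fun w : Fin g → ℂ => (z, w)) (by fun_prop)).mul hc)
    (by positivity)
    (fun γ w hw => by
      have h4 := L.norm_TT_le γ z w
      have h5 := hC2 w hw
      have h6 : ‖Complex.exp ((Real.pi / 2 : ℝ) * nsq (z - w))‖ =
          Real.exp (Real.pi / 2 * nsq (z - w)) := by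
        rw [Complex.norm_exp]; congr 1
        rw [Complex.re_mul_ofReal]; simp
      rw [norm_mul, h6] at h5
      rw [norm_mul]
      calc _ ≤ (Real.exp (Real.pi / 2 * nsq (z - w)) *
            Real.exp (-(Real.pi / 4) * nsq (γ : Fin g → ℂ))) * ‖h w‖ := by gcongr
        _ = (Real.exp (Real.pi / 2 * nsq (z - w)) * ‖h w‖) *
            Real.exp (-(Real.pi / 4) * nsq (γ : Fin g → ℂ)) := by ring
        _ ≤ _ := by gcongr)
  rw [this.tsum_eq]
  simp_rw [tsum_mul_right]
  rfl

lemma conj_TT (L : LatData Γ D a) (γ : Γ) (z w : Fin g → ℂ) :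
    (starRingEnd ℂ) (TT a γ z w) = nf (fun w => a γ * Complex.exp (Real.pi *
      (Hform g (z - γ) w + (Hform g z γ - Hform g γ γ / 2 - Hform g z z / 2)))) w := by
  rw [TT, map_mul, L.conj_chi_eq, fk, ← Complex.exp_conj, nf]
  rw [mul_left_comm, ← Complex.exp_add, mul_assoc, ← Complex.exp_add]
  congr 2
  simp only [map_mul, map_sub, map_div₀, Complex.conj_ofReal, Hform_conj, map_ofNat]
  simp only [Hform_add_left, Hform_add_right, Hform_sub_left, Hform_sub_right]
  ring

lemma repro_TT (L : LatData Γ D a) (γ : Γ) (z : Fin g → ℂ) :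
    ∫ w, fk z w * (starRingEnd ℂ) (TT a γ z w) = (starRingEnd ℂ) (TT a γ z z) := by
  simp_rw [L.conj_TT γ z]
  apply fk_repro (C := 1)
  · have := (contDiff_Hform (g := g) (z - γ) (n := 1)).differentiable (by simp)
    fun_prop
  · intro w
    rw [← L.conj_TT, Complex.norm_conj, L.norm_TT]
    rw [Real.exp_le_one_iff]
    have := nsq_nonneg (z - w - (γ : Fin g → ℂ))
    nlinarith [Real.pi_pos]

lemma KK_sq (L : LatData Γ D a) (z : Fin g → ℂ) :
    ∫ w in D, KK a z w * (starRingEnd ℂ) (KK a z w) = (starRingEnd ℂ) (KK a z z) := by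
  have := L.countable
  have hKc : Continuous fun w => KK a z w :=
    L.continuous_KK.comp (f := fun w : Fin g → ℂ => (z, w)) (by fun_prop)
  have hfz : Continuous fun w => fk z w :=
    continuous_fk.comp (f := fun w : Fin g → ℂ => (z, w)) (by fun_prop)
  rw [L.unfoldD (h := fun w => (starRingEnd ℂ) (KK a z w)) (Complex.continuous_conj.comp hKc)
    (fun γ w => L.conj_KK_shift z w γ)]
  have hcj : ∀ w, (starRingEnd ℂ) (KK a z w) = ∑' γ : Γ, (starRingEnd ℂ) (TT a γ z w) := by
    intro w; rw [KK, Complex.conj_tsum]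
  simp_rw [hcj, ← tsum_mul_left]
  have hcont : ∀ γ : Γ, Continuous fun w => fk z w * (starRingEnd ℂ) (TT a γ z w) := fun γ =>
    hfz.mul (Complex.continuous_conj.comp
      ((continuous_TT γ).comp (f := fun w : Fin g → ℂ => (z, w)) (by fun_prop)))
  have hbd : ∀ (γ : Γ) w, ‖fk z w * (starRingEnd ℂ) (TT a γ z w)‖ ≤
      Real.exp (-(Real.pi / 4) * nsq (z - w)) * Real.exp (-(Real.pi / 8) * nsq (γ : Fin g → ℂ)) := by
    intro γ w
    rw [norm_mul, Complex.norm_conj, norm_fk, L.norm_TT, ← Real.exp_add, ← Real.exp_add]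
    apply Real.exp_le_exp.mpr
    have h1 := nsq_half_le (z - w) γ
    have h2 := nsq_nonneg (z - w - (γ : Fin g → ℂ))
    nlinarith [mul_nonneg Real.pi_pos.le h2, mul_le_mul_of_nonneg_left h1 Real.pi_pos.le]
  have hg : Integrable fun w : Fin g → ℂ => Real.exp (-(Real.pi / 4) * nsq (z - w)) :=
    (rgauss_integrable (g := g) (b := Real.pi / 4) (by positivity)).comp_sub_left z
  have hint : ∀ γ : Γ, Integrable fun w => fk z w * (starRingEnd ℂ) (TT a γ z w) := fun γ =>
    (hg.mul_const _).mono' (hcont γ).aestronglyMeasurable (Filter.Eventually.of_forall (hbd γ))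
  rw [← integral_tsum_of_summable_integral_norm hint]
  · simp_rw [L.repro_TT]
  · refine Summable.of_nonneg_of_le (fun γ => integral_nonneg fun _ => norm_nonneg _) (fun γ => ?_)
      ((L.summ (Real.pi / 8) (by positivity)).mul_left
        (∫ w, Real.exp (-(Real.pi / 4) * nsq (z - w))))
    rw [← integral_mul_const]
    exact integral_mono (hint γ).norm (hg.mul_const _) (hbd γ)

lemma TT_diag (γ : Γ) (z : Fin g → ℂ) :
    TT a γ z z = a γ * Complex.exp (-(Real.pi / 2 : ℝ) * nsq (γ : Fin g → ℂ)) *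
      Complex.exp (Real.pi * (Hform g γ z - Hform g z γ)) := by
  rw [TT, chi, fk, mul_left_comm, mul_assoc, ← Complex.exp_add, ← Complex.exp_add, ← Hform_self]
  congr 2
  simp only [Hform_add_left, Hform_add_right]
  push_cast
  ring

lemma KK_diag_periodic (L : LatData Γ D a) (z : Fin g → ℂ) (δ : Γ) :
    KK a (z + δ) (z + δ) = KK a z z := by
  unfold KK
  refine tsum_congr fun γ => ?_
  rw [TT_diag, TT_diag]
  have : Complex.exp (Real.pi * (Hform g γ (z + δ) - Hform g (z + δ) γ)) =
      Complex.exp (Real.pi * (Hform g γ z - Hform g z γ)) *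
      Complex.exp (Real.pi * (Hform g γ δ - Hform g δ γ)) := by
    rw [← Complex.exp_add]; congr 1
    simp only [Hform_add_left, Hform_add_right]; ring
  rw [this, L.e_int, mul_one]

lemma char_int (L : LatData Γ D a) (γ : Γ) (hγ : γ ≠ 0) :
    ∫ z in D, Complex.exp (Real.pi * (Hform g γ z - Hform g z γ)) = 0 := by
  have := L.countable
  set ch : (Fin g → ℂ) → ℂ := fun z => Complex.exp (Real.pi * (Hform g γ z - Hform g z γ)) with hch
  have hadd : ∀ z y, ch (y + z) = ch y * ch z := by
    intro z y
    rw [hch]; simp only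
    rw [← Complex.exp_add]; congr 1
    simp only [Hform_add_left, Hform_add_right]; ring
  have hN : nsq (γ : Fin g → ℂ) ≠ 0 := fun h => hγ (Subtype.ext (nsq_eq_zero h))
  have hNc : (nsq (γ : Fin g → ℂ) : ℂ) ≠ 0 := by exact_mod_cast hN
  let y : Fin g → ℂ := (Complex.I / (2 * nsq (γ : Fin g → ℂ))) • (γ : Fin g → ℂ)
  have hy : ch y = -1 := by
    rw [hch]
    simp only [y, Hform_smul_left, Hform_smul_right, Hform_self]
    rw [← Complex.exp_pi_mul_I]
    congr 1
    simp only [map_div₀, Complex.conj_I, map_mul, Complex.conj_ofReal, map_ofNat]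
    field_simp
    ring
  have hfd2 := L.fd.vadd_of_comm y
  have hper : ∀ (δ : Γ) z, ch (δ +ᵥ z) = ch z := by
    intro δ z
    rw [AddSubgroup.vadd_def, vadd_eq_add, hadd]
    rw [hch]; simp only
    rw [L.e_int, one_mul]
  have h1 := L.fd.setIntegral_eq hfd2 hper
  have h2 : ∫ z in (y +ᵥ D), ch z = ∫ z in D, ch (y +ᵥ z) := by
    exact (measurePreserving_vadd y volume).setIntegral_image_emb
      (measurableEmbedding_const_vadd _) _ _
  rw [h2] at h1
  simp only [vadd_eq_add, hadd, hy] at h1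
  rw [integral_const_mul] at h1
  have : (2 : ℂ) * ∫ z in D, ch z = 0 := by linear_combination h1
  simpa using this

lemma KK_trace (L : LatData Γ D a) : ∫ z in D, KK a z z = 1 := by
  have := L.countable
  have hs := L.swapD (F := fun γ z => TT a γ z z) (C := 1) (t := Real.pi / 2)
    (fun γ => (continuous_TT γ).comp (f := fun w : Fin g → ℂ => (w, w)) (by fun_prop))
    (by positivity)
    (fun γ z _ => by rw [L.norm_TT, sub_self, zero_sub, nsq_neg, one_mul])
  have h0 : ∀ γ : Γ, γ ≠ 0 → ∫ z in D, TT a γ z z = 0 := by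
    intro γ hγ
    simp_rw [TT_diag]
    rw [integral_const_mul, L.char_int γ hγ, mul_zero]
  have h1 := hs.tsum_eq
  rw [tsum_eq_single 0 h0] at h1
  unfold KK
  rw [← h1]
  simp [TT_diag, L.a_zero, Hform_zero_left, Hform_zero_right, nsq, measureReal_def, L.vol]

lemma zero_of_int (L : LatData Γ D a) {p : (Fin g → ℂ) → ℝ} (hc : Continuous p) (h0 : ∀ z, 0 ≤ p z)
    (hper : ∀ (δ : Γ) z, p (z + δ) = p z) (hi : ∫ z in D, p z = 0) (z : Fin g → ℂ) : p z = 0 := by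
  have := L.countable
  have hint : Integrable p (volume.restrict D) := by
    have := L.integrableD (h := fun z => (p z : ℂ)) (by fun_prop)
    simpa using this.re
  have h1 := (integral_eq_zero_iff_of_nonneg (f := p) h0 hint).mp hi
  have hopen : IsOpen {z | p z ≠ 0} := isOpen_ne_fun hc continuous_const
  have h2 : volume ({z | p z ≠ 0} ∩ D) = 0 := by
    have h3 := ae_iff.mp h1
    rw [Measure.restrict_apply₀ ?_] at h3
    · simpa using h3
    · exact hopen.measurableSet.nullMeasurableSet
  have h3 := L.fd.measure_zero_of_invariant {z | p z ≠ 0} (fun δ => by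
    ext w
    rw [Set.mem_vadd_set_iff_neg_vadd_mem]
    simp only [Set.mem_ofPred_eq]
    rw [AddSubgroup.vadd_def, vadd_eq_add, add_comm, hper]) h2
  have h4 := hopen.eq_empty_of_measure_zero h3
  by_contra hz
  have : z ∈ {z | p z ≠ 0} := hz
  rw [h4] at this
  exact this

lemma rank_one (L : LatData Γ D a) {θ : (Fin g → ℂ) → ℂ} (hd : Differentiable ℂ θ) (hne : θ ≠ 0)
    (hh : ∀ (γ : Γ) w, nf θ (w + γ) = chi a γ w * nf θ w) :
    ∃ N : ℂ, N ≠ 0 ∧ ∀ z w, KK a z w * N = nf θ z * (starRingEnd ℂ) (nf θ w) := by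
  have := L.countable
  set f := nf θ with hf
  have hfc : Continuous f := by
    have h1 := hd.continuous
    have h2 := continuous_Hform (g := g) continuous_id continuous_id
    simp only [hf, nf_def]
    simp only [id] at h2
    fun_prop
  obtain ⟨C, hC0, hC⟩ := L.bounded_of_chi hfc hh
  have hrep : ∀ z, ∫ w in D, KK a z w * f w = f z := fun z => by
    rw [L.unfoldD hfc hh, fk_repro hd hC]
  have hfn : ∀ (δ : Γ) z, ‖f (z + δ)‖ = ‖f z‖ := fun δ z => by
    rw [hh, norm_mul, L.norm_chi, one_mul]
  set N : ℝ := ∫ w in D, ‖f w‖ ^ 2 with hN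
  have hN0 : N ≠ 0 := by
    intro h0
    apply hne
    ext z
    have := L.zero_of_int (p := fun z => ‖f z‖ ^ 2) (by fun_prop) (fun z => by positivity)
      (fun δ z => by rw [hfn]) h0 z
    simp only [pow_eq_zero_iff, norm_eq_zero, ne_eq, OfNat.ofNat_ne_zero, not_false_eq_true] at this
    rw [hf, nf_def] at this
    simpa using this
  have hNc : (N : ℂ) ≠ 0 := by exact_mod_cast hN0
  have hNint : ∫ w in D, f w * (starRingEnd ℂ) (f w) = N := by
    rw [hN, ← integral_complex_ofReal]
    congr 1; ext w
    rw [Complex.mul_conj, Complex.normSq_eq_norm_sq]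
  have hKz : ∀ z, Continuous fun w => KK a z w := fun z =>
    L.continuous_KK.comp (f := fun w : Fin g → ℂ => (z, w)) (by fun_prop)
  have hcj := Complex.continuous_conj
  let p : (Fin g → ℂ) → (Fin g → ℂ) → ℝ := fun z w =>
    ‖KK a z w - f z * (starRingEnd ℂ) (f w) / N‖ ^ 2
  have hpint : ∀ z, ((∫ w in D, p z w : ℝ) : ℂ) = (starRingEnd ℂ) (KK a z z) - ((‖f z‖ ^ 2 / N : ℝ) : ℂ) := by
    intro z
    have hk := hKz z
    have hA : Continuous fun w => (starRingEnd ℂ) (f w) := hcj.comp hfc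
    have hB : Continuous fun w => (starRingEnd ℂ) (KK a z w) := hcj.comp hk
    rw [← integral_complex_ofReal]
    have hexp : ∀ w, ((p z w : ℝ) : ℂ) =
        (KK a z w * (starRingEnd ℂ) (KK a z w) - (starRingEnd ℂ) (f z) / N * (KK a z w * f w)) -
        (f z / N * (starRingEnd ℂ) (KK a z w * f w) -
          f z * (starRingEnd ℂ) (f z) / N ^ 2 * (f w * (starRingEnd ℂ) (f w))) := by
      intro w
      simp only [p]
      rw [← Complex.normSq_eq_norm_sq, ← Complex.mul_conj]
      simp only [map_sub, map_mul, map_div₀, Complex.conj_ofReal, Complex.conj_conj]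
      ring
    simp_rw [hexp]
    have i1 : Integrable (fun w => KK a z w * (starRingEnd ℂ) (KK a z w)) (volume.restrict D) :=
      L.integrableD (hk.mul hB)
    have i2 : Integrable (fun w => (starRingEnd ℂ) (f z) / N * (KK a z w * f w))
      (volume.restrict D) :=
      (L.integrableD (hk.mul hfc)).const_mul ((starRingEnd ℂ) (f z) / N)
    have i3 : Integrable (fun w => f z / N * (starRingEnd ℂ) (KK a z w * f w))
      (volume.restrict D) :=
      (L.integrableD (hcj.comp (hk.mul hfc))).const_mul (f z / N)
    have i4 : Integrable (fun w => f z * (starRingEnd ℂ) (f z) / N ^ 2 *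
      (f w * (starRingEnd ℂ) (f w))) (volume.restrict D) :=
      (L.integrableD (hfc.mul hA)).const_mul (f z * (starRingEnd ℂ) (f z) / N ^ 2)
    have i12 : Integrable (fun w => KK a z w * (starRingEnd ℂ) (KK a z w) -
      (starRingEnd ℂ) (f z) / N * (KK a z w * f w)) (volume.restrict D) := i1.sub i2
    have i34 : Integrable (fun w => f z / N * (starRingEnd ℂ) (KK a z w * f w) -
      f z * (starRingEnd ℂ) (f z) / N ^ 2 * (f w * (starRingEnd ℂ) (f w)))
      (volume.restrict D) := i3.sub i4
    rw [integral_sub i12 i34, integral_sub i1 i2, integral_sub i3 i4,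
      integral_const_mul, integral_const_mul, integral_const_mul, integral_conj, hrep, hNint,
      L.KK_sq]
    push_cast
    rw [← Complex.mul_conj']
    field_simp
    ring
  have hreal : ∀ z, ∫ w in D, p z w = (KK a z z).re - ‖f z‖ ^ 2 / N := by
    intro z
    have := congrArg Complex.re (hpint z)
    rw [Complex.ofReal_re, Complex.sub_re, Complex.conj_re, Complex.ofReal_re] at this
    exact this
  have hKd : Continuous fun w => KK a w w :=
    L.continuous_KK.comp (f := fun w : Fin g → ℂ => (w, w)) (by fun_prop)
  have hzero : ∀ z, ∫ w in D, p z w = 0 := by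
    intro z
    refine L.zero_of_int (p := fun z => ∫ w in D, p z w) ?_ (fun z => integral_nonneg fun w => by
      positivity) ?_ ?_ z
    · simp_rw [hreal]
      exact (Complex.continuous_re.comp hKd).sub (by fun_prop)
    · intro δ z
      simp only [hreal]
      rw [L.KK_diag_periodic, hfn]
    · simp_rw [hreal]
      have i1 : Integrable (fun z => (KK a z z).re) (volume.restrict D) := (L.integrableD hKd).re
      have i2 : Integrable (fun z => ‖f z‖ ^ 2 / N) (volume.restrict D) := by
        have := (L.integrableD (h := fun z => ((‖f z‖ ^ 2 / N : ℝ) : ℂ)) (by fun_prop)).re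
        simpa only [RCLike.re_to_complex, Complex.ofReal_re] using this
      rw [integral_sub i1 i2, integral_div, ← hN, div_self hN0]
      have h5 := integral_re (𝕜 := ℂ) (L.integrableD hKd)
      simp only [RCLike.re_to_complex] at h5
      rw [h5, L.KK_trace]
      simp
  refine ⟨N, hNc, fun z w => ?_⟩
  have hk := hKz z
  have hA : Continuous fun w => (starRingEnd ℂ) (f w) := hcj.comp hfc
  have hp : p z w = 0 := by
    refine L.zero_of_int (p := p z) (by simp only [p]; fun_prop) (fun w => by positivity) ?_ (hzero z) w
    intro δ w
    simp only [p]
    congr 1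
    rw [← Complex.norm_conj, ← Complex.norm_conj (KK a z w - _)]
    simp only [map_sub, map_div₀, map_mul, Complex.conj_conj, Complex.conj_ofReal]
    rw [L.conj_KK_shift, hh]
    rw [← one_mul ‖_ - (starRingEnd ℂ) (f z) * f w / _‖, ← L.norm_chi δ w, ← norm_mul]
    congr 1
    ring
  simp only [p, pow_eq_zero_iff, norm_eq_zero, ne_eq, OfNat.ofNat_ne_zero, not_false_eq_true] at hp
  rw [sub_eq_zero.mp hp]
  field_simp

lemma eigen (L : LatData Γ D a) {θ : (Fin g → ℂ) → ℂ} (hd : Differentiable ℂ θ) (hne : θ ≠ 0)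
    (hh : ∀ (γ : Γ) w, nf θ (w + γ) = chi a γ w * nf θ w)
    (hI : ∀ γ : Γ, ∃ γ' : Γ, (γ' : Fin g → ℂ) = Complex.I • (γ : Fin g → ℂ) ∧ a γ' = a γ)
    (z : Fin g → ℂ) :
    θ (Complex.I • z) = (∫ w in D, KK a (Complex.I • w) w) * θ z := by
  obtain ⟨N, hN, hK⟩ := L.rank_one hd hne hh
  let θ' : (Fin g → ℂ) → ℂ := fun z => θ (Complex.I • z)
  have hnf' : ∀ w, nf θ' w = nf θ (Complex.I • w) := by
    intro w
    simp only [nf, θ', Hform_smul_left, Hform_smul_right, Complex.conj_I]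
    rw [← mul_assoc Complex.I]; simp
  have hd' : Differentiable ℂ θ' := by simp only [θ']; fun_prop
  have hfc' : Continuous (nf θ') := by
    have h1 := hd'.continuous
    have h2 := continuous_Hform (g := g) continuous_id continuous_id
    simp only [nf_def]
    simp only [id] at h2
    fun_prop
  have hh' : ∀ (γ : Γ) w, nf θ' (w + γ) = chi a γ w * nf θ' w := by
    intro γ w
    obtain ⟨γ', h1, h2⟩ := hI γ
    rw [hnf', hnf', smul_add, ← h1, hh]
    congr 1
    rw [chi, chi, h1, h2]
    congr 3
    simp only [Hform_smul_left, Hform_smul_right, Complex.conj_I]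
    rw [← mul_assoc, ← mul_assoc]; simp
  obtain ⟨C, hC0, hC⟩ := L.bounded_of_chi hfc' hh'
  have hrep : ∫ w in D, KK a z w * nf θ' w = nf θ' z := by
    rw [L.unfoldD hfc' hh', fk_repro hd' hC]
  have h1 : ∀ w, KK a z w * nf θ' w = nf θ z * KK a (Complex.I • w) w := by
    intro w
    have e1 := hK z w
    have e2 := hK (Complex.I • w) w
    rw [hnf']
    apply mul_right_cancel₀ hN
    linear_combination nf θ (Complex.I • w) * e1 - nf θ z * e2
  simp_rw [h1] at hrep
  rw [integral_const_mul, nf_def θ', nf_def θ] at hrep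
  have he := Complex.exp_ne_zero (-(Real.pi / 2 : ℂ) * Hform g z z)
  apply mul_right_cancel₀ he
  simp only [θ'] at hrep
  rw [← hrep]; ring
end LatData
end Lat

end PartHelper3

section PartHelper4
open MeasureTheory
section Lef
variable {g : ℕ} {Γ : AddSubgroup (Fin g → ℂ)} {D : Set (Fin g → ℂ)} {a : Γ → ℂ}

namespace LatData

lemma TT_I (γ : Γ) (w : Fin g → ℂ) :
    TT a γ (Complex.I • w) w = a γ * Complex.exp (-(Real.pi * Complex.I / 2) *
      nsq (γ : Fin g → ℂ)) * Complex.exp (-(Real.pi * (1 - Complex.I)) *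
        nsq (w - (-(1 + Complex.I) / 2) • (γ : Fin g → ℂ))) := by
  rw [TT, chi, fk, mul_left_comm, mul_assoc, ← Complex.exp_add, ← Complex.exp_add, ← Hform_self,
    ← Hform_self]
  congr 2
  simp only [Hform_add_left, Hform_add_right, Hform_sub_left, Hform_sub_right, Hform_smul_left,
    Hform_smul_right, Complex.conj_I, map_div₀, map_neg, map_add, map_one, map_ofNat]
  have h : Complex.I ^ 2 = -1 := Complex.I_sq
  have h3 : Complex.I ^ 3 = -Complex.I := by rw [pow_succ, h]; ring
  ring_nf
  simp only [h, h3]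
  ring

lemma lefschetz (L : LatData Γ D a) {B : Type*} [AddCommGroup B] [Fintype B] (s : Γ →+ B)
    (hs : Function.Surjective s) (J : Γ →+ Γ)
    (hJ : ∀ δ : Γ, (J δ : Fin g → ℂ) = (Complex.I - 1) • (δ : Fin g → ℂ))
    (hk : ∀ γ, s γ = 0 ↔ ∃ δ, γ = J δ) (G : B → ℂ)
    (hG : ∀ γ : Γ, a γ * Complex.exp (-(Real.pi * Complex.I / 2) *
      nsq (γ : Fin g → ℂ)) = G (s γ)) :
    ∫ w in D, KK a (Complex.I • w) w = (1 - Complex.I) ^ (-(g : ℤ)) * ∑ b, G b := by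
  have := L.countable
  have hb : 0 < ((Real.pi : ℂ) * (1 - Complex.I)).re := by simp [Real.pi_pos]
  obtain ⟨C, hC0, hC⟩ := L.bounded_on_D (h := fun w : Fin g → ℂ =>
    Complex.exp ((Real.pi / 2 : ℝ) * nsq (Complex.I • w - w))) (by
      have h3 := continuous_nsq (g := g)
      fun_prop)
  have hsw := L.swapD (F := fun γ w => TT a γ (Complex.I • w) w) (C := C) (t := Real.pi / 4)
    (fun γ => (continuous_TT γ).comp (f := fun w : Fin g → ℂ => (Complex.I • w, w)) (by fun_prop))
    (by positivity)
    (fun γ w hw => by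
      refine (L.norm_TT_le γ _ w).trans ?_
      have h5 := hC w hw
      have h6 : ‖Complex.exp ((Real.pi / 2 : ℝ) * nsq (Complex.I • w - w))‖ =
          Real.exp (Real.pi / 2 * nsq (Complex.I • w - w)) := by
        rw [Complex.norm_exp]; congr 1
        rw [Complex.re_mul_ofReal]; simp
      rw [h6] at h5
      gcongr)
  have hJinj : Function.Injective J := by
    intro x y h
    have h1 := congrArg (fun t : Γ => (t : Fin g → ℂ)) h
    simp only [hJ] at h1
    have h0 : (Complex.I - 1) ≠ 0 := by
      intro h; have := congrArg Complex.re h; simp at this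
    exact Subtype.ext (smul_right_injective _ h0 h1)
  choose σ hσ using hs
  let E : B × Γ → Γ := fun p => σ p.1 + J p.2
  have hsJ : ∀ δ, s (J δ) = 0 := fun δ => (hk _).2 ⟨δ, rfl⟩
  have hE : Function.Bijective E := by
    constructor
    · rintro ⟨b, δ⟩ ⟨b', δ'⟩ h
      simp only [E] at h
      have h1 := congrArg s h
      simp only [map_add, hsJ, hσ, add_zero] at h1
      subst h1
      simp only [add_right_inj] at h
      rw [hJinj h]
    · intro γ
      obtain ⟨δ, hδ⟩ := (hk (γ - σ (s γ))).1 (by simp [hσ])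
      exact ⟨(s γ, δ), by simp only [E]; rw [← hδ]; abel⟩
  let Ee := Equiv.ofBijective E hE
  have h1 := hsw.tsum_eq
  have hsum := hsw.summable
  have hsum2 : Summable fun c : B × Γ => ∫ w in D, TT a (Ee c) (Complex.I • w) w :=
    (Ee.summable_iff).2 hsum
  rw [← Ee.tsum_eq, Summable.tsum_prod hsum2, tsum_fintype] at h1
  unfold KK
  rw [← h1, Finset.mul_sum]
  refine Finset.sum_congr rfl fun b _ => ?_
  set z0 : Fin g → ℂ := (-(1 + Complex.I) / 2) • (σ b : Fin g → ℂ) with hz0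
  have h2 : ∀ δ : Γ, ∫ w in D, TT a (Ee (b, δ)) (Complex.I • w) w =
      ∫ w in D, G b * Complex.exp (-(Real.pi * (1 - Complex.I)) * nsq ((-δ +ᵥ w) - z0)) := by
    intro δ
    congr 1
    ext w
    rw [TT_I, hG]
    have e1 : s (Ee (b, δ)) = b := by
      change s (σ b + J δ) = b
      rw [map_add, hsJ, hσ, add_zero]
    have e2 : ((Ee (b, δ) : Γ) : Fin g → ℂ) = (σ b : Fin g → ℂ) + (Complex.I - 1) • (δ : Fin g → ℂ) := by
      change ((σ b + J δ : Γ) : Fin g → ℂ) = _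
      rw [AddSubgroup.coe_add, hJ]
    rw [e1, e2]
    congr 5
    rw [AddSubgroup.vadd_def, vadd_eq_add, smul_add, smul_smul, ← hz0]
    have : -(1 + Complex.I) / 2 * (Complex.I - 1) = 1 := by
      have h : Complex.I ^ 2 = -1 := Complex.I_sq
      linear_combination -h / 2
    rw [this]
    simp only [AddSubgroup.coe_neg, one_smul]
    abel
  simp_rw [h2]
  have hint : Integrable fun w : Fin g → ℂ =>
      G b * Complex.exp (-(Real.pi * (1 - Complex.I)) * nsq (w - z0)) :=
    ((gauss_integrable (g := g) hb).comp_sub_right z0).const_mul (G b)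
  rw [← L.fd.integral_eq_tsum' _ hint, integral_const_mul,
    integral_sub_right_eq_self (fun w : Fin g → ℂ => Complex.exp (-(Real.pi * (1 - Complex.I)) * nsq w)) z0,
    gauss_integral hb]
  have hpi : (Real.pi : ℂ) ≠ 0 := by exact_mod_cast Real.pi_ne_zero
  rw [div_mul_eq_div_div, div_self hpi, one_div, inv_pow, zpow_neg, zpow_natCast, mul_comm]

end LatData
end Lef

end PartHelper4

section PartHelper5
open MeasureTheory
section Latt
variable {g : ℕ}

lemma summ_span {ι : Type*} [Finite ι] (b : Module.Basis ι ℝ (Fin g → ℂ)) (t : ℝ) (ht : 0 < t) :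
    Summable fun γ : Submodule.span ℤ (Set.range b) => Real.exp (-t * nsq (γ : Fin g → ℂ)) := by
  set L := Submodule.span ℤ (Set.range b) with hL
  set k := Module.finrank ℤ L + 1 with hk
  have h1 := ZLattice.summable_norm_pow_inv L (2 * k) (by omega)
  refine Summable.of_norm_bounded_eventually (h1.mul_left ((k.factorial : ℝ) / t ^ k)) ?_
  rw [Filter.eventually_cofinite]
  refine (Set.finite_singleton (0 : L)).subset fun γ hγ => ?_
  by_contra h0
  apply hγ
  have hn : 0 < ‖γ‖ := norm_pos_iff.2 h0
  rw [Real.norm_eq_abs, Real.abs_exp]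
  have h2 : ‖γ‖ ^ 2 ≤ nsq (γ : Fin g → ℂ) := norm_sq_le_nsq _
  have h3 := Real.pow_div_factorial_le_exp (t * ‖γ‖ ^ 2) (by positivity) k
  have hf : (0 : ℝ) < k.factorial := by exact_mod_cast k.factorial_pos
  calc Real.exp (-t * nsq (γ : Fin g → ℂ)) ≤ Real.exp (-(t * ‖γ‖ ^ 2)) := by
        apply Real.exp_le_exp.mpr; nlinarith
    _ = (Real.exp (t * ‖γ‖ ^ 2))⁻¹ := Real.exp_neg _
    _ ≤ ((t * ‖γ‖ ^ 2) ^ k / k.factorial)⁻¹ := by gcongr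
    _ = _ := by rw [mul_pow, ← pow_mul, inv_pow, inv_div]; field_simp

noncomputable def stdB (g : ℕ) : Module.Basis (Σ _ : Fin g, Fin 2) ℝ (Fin g → ℂ) :=
  Pi.basis fun _ : Fin g => Complex.basisOneI

lemma stdB_repr (x : Fin g → ℂ) (j : Fin g) (k : Fin 2) :
    (stdB g).repr x ⟨j, k⟩ = ![(x j).re, (x j).im] k := by
  rw [stdB, Pi.basis_repr, Complex.coe_basisOneI_repr]

lemma re_Hform_eq (x y : Fin g → ℂ) :
    (Hform g x y).re = ∑ i, (stdB g).repr x i * (stdB g).repr y i := by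
  rw [Fintype.sum_sigma, Hform, Complex.re_sum]
  refine Finset.sum_congr rfl fun j _ => ?_
  rw [Fin.sum_univ_two]
  simp [stdB_repr]

lemma vol_stdB : volume (ZSpan.fundamentalDomain (stdB g)) = 1 := by
  have h : ZSpan.fundamentalDomain (stdB g) = Set.univ.pi fun _ : Fin g =>
      Complex.measurableEquivPi ⁻¹' (Set.univ.pi fun _ : Fin 2 => Set.Ico (0:ℝ) 1) := by
    ext x
    simp only [ZSpan.mem_fundamentalDomain, Set.mem_pi, Set.mem_univ, true_implies,
      Set.mem_preimage, Sigma.forall, stdB_repr, Complex.measurableEquivPi_apply]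
  rw [h, volume_pi, Measure.pi_pi, Finset.prod_const,
    Complex.volume_preserving_equiv_pi.measure_preimage, volume_pi, Measure.pi_pi]
  · simp
  · exact (MeasurableSet.pi Set.countable_univ (fun _ _ => measurableSet_Ico)).nullMeasurableSet

lemma lat_exists (Γ : AddSubgroup (Fin g → ℂ))
    [Module.Free ℤ ↥Γ] [Module.Finite ℤ ↥Γ]
    (hrank : Module.finrank ℤ ↥Γ = 2 * g)
    (hspan : Submodule.span ℝ (Γ : Set (Fin g → ℂ)) = ⊤)
    (Imul : ↥Γ →+ ↥Γ)
    (hImul : ∀ x : ↥Γ, (Imul x : Fin g → ℂ) = Complex.I • (x : Fin g → ℂ))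
    (hHint : ∀ x y : ↥Γ, ∃ a b : ℤ, Hform g x y = (a : ℂ) + (b : ℂ) * Complex.I)
    (hunimod : ∀ φ : ↥Γ →ₗ[ℤ] ℤ, ∃! x : ↥Γ, ∀ y : ↥Γ, (Hform g x y).im = (φ y : ℝ)) :
    ∃ D : Set (Fin g → ℂ), Countable Γ ∧ IsAddFundamentalDomain Γ D volume ∧
      Bornology.IsBounded D ∧ volume D = 1 ∧ (∀ z, ∃ γ : Γ, ∃ w ∈ D, z = w + γ) ∧
      ∀ t : ℝ, 0 < t → Summable fun γ : Γ => Real.exp (-t * nsq (γ : Fin g → ℂ)) := by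
  classical
  have hcard : Fintype.card (Σ _ : Fin g, Fin 2) = 2 * g := by simp [mul_comm]
  let b0 : Module.Basis (Σ _ : Fin g, Fin 2) ℤ Γ :=
    (Module.finBasisOfFinrankEq ℤ Γ hrank).reindex (Fintype.equivFinOfCardEq hcard).symm
  let v : (Σ _ : Fin g, Fin 2) → (Fin g → ℂ) := fun i => (b0 i : Fin g → ℂ)
  have hrep : ∀ γ : Γ, (γ : Fin g → ℂ) = ∑ i, (b0.repr γ i) • v i := by
    intro γ
    have := congrArg (AddSubgroup.subtype Γ) (b0.sum_repr γ)
    rw [map_sum] at this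
    rw [AddSubgroup.coe_subtype] at this
    rw [← this]
    rfl
  have hmem : ∀ y : Fin g → ℂ, y ∈ Γ ↔ y ∈ Submodule.span ℤ (Set.range v) := by
    intro y
    constructor
    · intro hy
      have := hrep ⟨y, hy⟩
      simp only at this
      rw [this]
      exact Submodule.sum_mem _ fun i _ => Submodule.smul_mem _ _ (Submodule.subset_span ⟨i, rfl⟩)
    · intro hy
      have h1 : Submodule.span ℤ (Set.range v) ≤ AddSubgroup.toIntSubmodule Γ := by
        rw [Submodule.span_le]
        rintro _ ⟨i, rfl⟩
        exact (b0 i).2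
      exact h1 hy
  have hle : ⊤ ≤ Submodule.span ℝ (Set.range v) := by
    rw [← hspan, Submodule.span_le]
    intro y hy
    have := (hmem y).1 hy
    exact Submodule.span_subset_span ℤ ℝ _ this
  have hfin : Fintype.card (Σ _ : Fin g, Fin 2) = Module.finrank ℝ (Fin g → ℂ) :=
    (Module.finrank_eq_card_basis (stdB g)).symm
  let b : Module.Basis (Σ _ : Fin g, Fin 2) ℝ (Fin g → ℂ) :=
    basisOfTopLeSpanOfCardEqFinrank v hle hfin
  have hbv : (b : (Σ _ : Fin g, Fin 2) → (Fin g → ℂ)) = v :=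
    coe_basisOfTopLeSpanOfCardEqFinrank v hle hfin
  have hΓ : Γ = (Submodule.span ℤ (Set.range b)).toAddSubgroup := by
    ext y
    rw [hbv, hmem]; rfl
  -- determinant
  have hdet : |(stdB g).det b| = 1 := by
    choose A Bz hAB using hHint
    let G : Matrix (Σ _ : Fin g, Fin 2) (Σ _ : Fin g, Fin 2) ℤ := fun i j => A (b0 i) (b0 j)
    have hG : ∀ i j, (G i j : ℝ) = (Hform g (v i) (v j)).re := by
      intro i j
      simp only [G, v]
      rw [hAB]; simp
    choose u hu using fun j => (hunimod (b0.coord j)).exists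
    let N : Matrix (Σ _ : Fin g, Fin 2) (Σ _ : Fin g, Fin 2) ℤ := fun i j => b0.repr (Imul (u i)) j
    have hNG : N * G = 1 := by
      ext j k
      have h1 : (Hform g (Imul (u j)) (b0 k)).re = ((1 : Matrix (Σ _ : Fin g, Fin 2) (Σ _ : Fin g, Fin 2) ℤ) j k : ℝ) := by
        rw [hImul, Hform_smul_left]
        have := hu j (b0 k)
        simp only [Complex.conj_I, Complex.mul_re, Complex.neg_re, Complex.I_re, Complex.neg_im,
          Complex.I_im]
        rw [this, Matrix.one_apply]
        simp [Finsupp.single_apply, eq_comm]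
        split_ifs <;> simp
      have h2 : (Hform g (Imul (u j)) (b0 k)).re = (((N * G) j k : ℤ) : ℝ) := by
        rw [Matrix.mul_apply]
        push_cast
        simp only [hG]
        conv_lhs => rw [hrep (Imul (u j))]
        rw [re_Hform_eq]
        simp only [re_Hform_eq, map_sum, map_zsmul, Finsupp.coe_finsetSum, Finset.sum_apply,
          Finset.sum_mul, Finset.mul_sum]
        rw [Finset.sum_comm]
        refine Finset.sum_congr rfl fun i _ => Finset.sum_congr rfl fun l _ => ?_
        simp only [N, v, Finsupp.smul_apply, zsmul_eq_mul]
        ring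
      rw [h1] at h2
      exact_mod_cast h2.symm
    have hdu : IsUnit G.det := by
      have := congrArg Matrix.det hNG
      rw [Matrix.det_mul, Matrix.det_one] at this
      exact IsUnit.of_mul_eq_one_right _ this
    have hGP : G.map (Int.cast : ℤ → ℝ) = ((stdB g).toMatrix b).transpose * (stdB g).toMatrix b := by
      ext i j
      rw [Matrix.map_apply, hG, re_Hform_eq, Matrix.mul_apply]
      simp only [Matrix.transpose_apply, Module.Basis.toMatrix_apply, hbv]
    have h3 : ((G.det : ℤ) : ℝ) = (stdB g).det b * (stdB g).det b := by
      have h4 := congrArg Matrix.det hGP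
      rw [Matrix.det_mul, Matrix.det_transpose, ← Module.Basis.det_apply] at h4
      rw [← h4]
      exact (Int.castRingHom ℝ).map_det G
    rcases Int.isUnit_iff.1 hdu with h | h
    · rw [h] at h3
      rw [← abs_mul_abs_self] at h3
      have := abs_nonneg ((stdB g).det b)
      push_cast at h3
      nlinarith
    · rw [h] at h3
      push_cast at h3
      nlinarith [mul_self_nonneg ((stdB g).det b)]
  refine ⟨ZSpan.fundamentalDomain b, ?_, ?_, ZSpan.fundamentalDomain_isBounded b, ?_, ?_, ?_⟩
  · exact b0.repr.toEquiv.countable_iff.2 inferInstance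
  · have := ZSpan.isAddFundamentalDomain' b (volume : Measure (Fin g → ℂ))
    rw [← hΓ] at this
    exact this
  · rw [ZSpan.measure_fundamentalDomain b volume (stdB g), hdet, vol_stdB]; simp
  · intro z
    have hm : ((ZSpan.floor b z : Submodule.span ℤ (Set.range b)) : Fin g → ℂ) ∈ Γ := by
      rw [hmem, ← hbv]; exact (ZSpan.floor b z).2
    refine ⟨⟨_, hm⟩, ZSpan.fract b z, ZSpan.fract_mem_fundamentalDomain b z, ?_⟩
    rw [ZSpan.fract]; simp
  · intro t ht
    have := summ_span b t ht
    rw [hΓ]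
    exact this
end Latt

end PartHelper5

section Fin6

lemma iPow_int (n : ℤ) : iPow (n : ZMod 4) = Complex.exp (Real.pi * Complex.I / 2 * n) := by
  have h1 : ((((n : ZMod 4).val : ℕ) : ℤ)) = n % 4 := ZMod.val_intCast n
  have hI : Complex.I = Complex.exp (Real.pi * Complex.I / 2) := by
    rw [mul_div_right_comm, Complex.exp_pi_div_two_mul_I]
  have h2 : iPow (n : ZMod 4) = Complex.exp (Real.pi * Complex.I / 2 * (n : ZMod 4).val) := by
    rw [iPow, mul_comm, Complex.exp_nat_mul, ← hI]
  have h3 : (n : ℂ) = ((n : ZMod 4).val : ℂ) + 4 * ((n / 4 : ℤ) : ℂ) := by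
    have h4 : n = (((n : ZMod 4).val : ℕ) : ℤ) + 4 * (n / 4) := by rw [h1]; omega
    exact_mod_cast h4
  rw [h2, Complex.exp_eq_exp_iff_exists_int]
  refine ⟨-(n / 4), ?_⟩
  rw [h3]; push_cast; ring

lemma zmod4_int (c : ZMod 4) : ∃ n : ℤ, (n : ZMod 4) = c := ZMod.intCast_surjective c

lemma iPow_add (c d : ZMod 4) : iPow (c + d) = iPow c * iPow d := by
  obtain ⟨n, rfl⟩ := zmod4_int c
  obtain ⟨k, rfl⟩ := zmod4_int d
  rw [← Int.cast_add, iPow_int, iPow_int, iPow_int, ← Complex.exp_add]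
  congr 1; push_cast; ring

lemma iPow_zero' : iPow 0 = 1 := by simp [iPow]

lemma emb2_int (n : ℤ) : emb2 (n : ZMod 2) = ((2 * n : ℤ) : ZMod 4) := by
  have h1 : ((((n : ZMod 2).val : ℕ) : ℤ)) = n % 2 := ZMod.val_intCast n
  have h2 : emb2 (n : ZMod 2) = ((2 * (((n : ZMod 2).val : ℕ) : ℤ) : ℤ) : ZMod 4) := by
    rw [emb2]; push_cast; rfl
  rw [h2, h1, ZMod.intCast_eq_intCast_iff]
  unfold Int.ModEq; push_cast; omega

lemma brown_congr (m g : ℕ) (t : ZMod 4) (S : ℂ) (h : Complex.I ^ m * iPow t =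
      (1 - Complex.I) ^ (-(g : ℤ)) * S) (σ : ZMod 8) (hS : S = (Real.sqrt 2 : ℂ) ^ g *
          Complex.exp ((Real.pi : ℂ) * Complex.I * (σ.val : ℂ) / 4)) :
    ((2 * m : ℕ) : ZMod 8) = σ + (g : ZMod 8) - 2 * (t.val : ZMod 8) := by
  have h2 : (Real.sqrt 2 : ℂ) * Real.sqrt 2 = 2 := by
    rw [← Complex.ofReal_mul, Real.mul_self_sqrt (by norm_num)]; norm_num
  have hs0 : (Real.sqrt 2 : ℂ) ≠ 0 := by
    intro h0; rw [h0] at h2; norm_num at h2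
  have hE : (1 - Complex.I) * Complex.exp (Real.pi * Complex.I / 4) = Real.sqrt 2 := by
    have : (Real.pi * Complex.I / 4 : ℂ) = ((Real.pi / 4 : ℝ) : ℂ) * Complex.I := by
      push_cast; ring
    rw [this, Complex.exp_mul_I, ← Complex.ofReal_cos, ← Complex.ofReal_sin,
      Real.cos_pi_div_four, Real.sin_pi_div_four]
    push_cast
    linear_combination (-(Real.sqrt 2 : ℂ) / 2) * Complex.I_sq
  have h10 : (1 - Complex.I) ≠ 0 := by
    intro h0; rw [h0, zero_mul] at hE; exact hs0 hE.symm
  have hI : Complex.I = Complex.exp (Real.pi * Complex.I / 2) := by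
    rw [mul_div_right_comm, Complex.exp_pi_div_two_mul_I]
  have hIp : ∀ n : ℕ, Complex.I ^ n = Complex.exp (n * (Real.pi * Complex.I / 2)) := by
    intro n; rw [Complex.exp_nat_mul, ← hI]
  rw [hS, ← hE, mul_pow, ← mul_assoc, ← mul_assoc, zpow_neg, zpow_natCast,
    inv_mul_cancel₀ (pow_ne_zero _ h10), one_mul, iPow, ← pow_add, hIp, ← Complex.exp_nat_mul,
    ← Complex.exp_add, Complex.exp_eq_exp_iff_exists_int] at h
  obtain ⟨n, hn⟩ := h
  have hpi : (Real.pi : ℂ) * Complex.I ≠ 0 :=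
    mul_ne_zero (by exact_mod_cast Real.pi_ne_zero) Complex.I_ne_zero
  have h3 : (2 * (m : ℂ) + 2 * (t.val : ℂ)) = g + σ.val + 8 * n := by
    apply mul_left_cancel₀ hpi
    push_cast at hn
    linear_combination 4 * hn
  have h4 : (2 * (m : ℤ) + 2 * (t.val : ℤ)) = g + σ.val + 8 * n := by exact_mod_cast h3
  have h5 := congrArg (Int.cast : ℤ → ZMod 8) h4
  push_cast at h5
  have h8 : (8 : ZMod 8) = 0 := rfl
  rw [ZMod.natCast_zmod_val σ, h8, zero_mul, add_zero] at h5
  push_cast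
  linear_combination h5
end Fin6

/-- Let `θ` be a theta function for `q`, let `x ∈ ℂ^g` with `2x ∈ Γ` and
`i·x − x ∈ Γ`, let `α ∈ A_i` be the class of `2x` in `A₂`, and let `m` be the order of
vanishing of `θ` at `x`.  Then `i^m · i^{Q_q(α)} = (1 − i)^{−g} · ∑_{β ∈ A_i} i^{Q_q(β)}`;
equivalently, writing the Gauss sum as `2^{g/2}·e^{iπσ/4}` with `σ ∈ ℤ/8ℤ` the Brown
invariant of `Q_q`, one has `2m ≡ σ + g − 2Q_q(α) (mod 8)`. -/
theorem statement1 (g : ℕ) (hg : 1 ≤ g)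
    (Γ : AddSubgroup (Fin g → ℂ))
    [Module.Free ℤ ↥Γ] [Module.Finite ℤ ↥Γ]
    (hrank : Module.finrank ℤ ↥Γ = 2 * g)
    (hspan : Submodule.span ℝ (Γ : Set (Fin g → ℂ)) = ⊤)
    -- multiplication by `i` preserves `Γ`
    (Imul : ↥Γ →+ ↥Γ)
    (hImul : ∀ x : ↥Γ, (Imul x : Fin g → ℂ) = Complex.I • (x : Fin g → ℂ))
    -- `H` takes values in `ℤ[i]` on `Γ × Γ`
    (hHint : ∀ x y : ↥Γ, ∃ a b : ℤ, Hform g x y = (a : ℂ) + (b : ℂ) * Complex.I)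
    -- `E := Im H` is a unimodular pairing on `Γ`
    (hunimod : ∀ φ : ↥Γ →ₗ[ℤ] ℤ, ∃! x : ↥Γ, ∀ y : ↥Γ, (Hform g x y).im = (φ y : ℝ))
    -- `A₂ := Γ/2Γ`
    (A₂ : Type) [AddCommGroup A₂] [Module (ZMod 2) A₂] [Finite A₂]
    (pr : ↥Γ →+ A₂) (hpr : Function.Surjective pr)
    (hker : ∀ x : ↥Γ, pr x = 0 ↔ ∃ y : ↥Γ, x = 2 • y)
    -- the involution `ī` induced by `i`
    (Ibar : A₂ →ₗ[ZMod 2] A₂) (hIbar : ∀ x : ↥Γ, Ibar (pr x) = pr (Imul x))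
    -- the symplectic form `e` induced by `E`
    (e : A₂ →ₗ[ZMod 2] A₂ →ₗ[ZMod 2] ZMod 2)
    (he : ∀ x y : ↥Γ, ∀ n : ℤ, (Hform g x y).im = (n : ℝ) → e (pr x) (pr y) = (n : ZMod 2))
    -- the quadratic form `Q` induced by `x ↦ S(x, x) mod 4`
    (Q : A₂ → ZMod 4)
    (hQ : ∀ x : ↥Γ, ∀ n : ℤ, (Hform g x x).re = (n : ℝ) → Q (pr x) = (n : ZMod 4))
    -- an `ī`-invariant quadratic form `q` associated to `e`
    (q : A₂ → ZMod 4)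
    (hq : ∀ x y : A₂, q (x + y) = q x + q y + emb2 (e x y))
    (hqi : ∀ x : A₂, q (Ibar x) = q x)
    -- `Q_q`, determined on `A_i = ε(A₂)` by `Q_q(εα) = q(α) − Q(α)`
    (Qq : A₂ → ZMod 4)
    (hQq : ∀ α : A₂, Qq (α + Ibar α) = q α - Q α)
    -- `θ` is a theta function for `q`
    (θ : (Fin g → ℂ) → ℂ)
    (hθd : Differentiable ℂ θ)
    (hθne : θ ≠ 0)
    (hθfe : ∀ (γ : ↥Γ) (z : Fin g → ℂ), θ (z + (γ : Fin g → ℂ)) =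
      iPow (q (pr γ)) *
          Complex.exp ((Real.pi : ℂ) *
            Hform g (γ : Fin g → ℂ) (z + (2 : ℂ)⁻¹ • (γ : Fin g → ℂ))) *
        θ z)
    -- a point `x` with `2x ∈ Γ` and `i·x − x ∈ Γ`
    (x : Fin g → ℂ)
    (hx2 : (2 : ℂ) • x ∈ Γ)
    (hix : Complex.I • x - x ∈ Γ)
    -- `m` is the order of vanishing of `θ` at `x`
    (m : ℕ)
    (hm : iteratedFDeriv ℂ m θ x ≠ 0)
    (hmmin : ∀ k < m, iteratedFDeriv ℂ k θ x = 0) :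
    (Complex.I ^ m * iPow (Qq (pr ⟨(2 : ℂ) • x, hx2⟩)) =
      (1 - Complex.I) ^ (-(g : ℤ)) * ∑ᶠ β : ↥(Asub Ibar), iPow (Qq (β : A₂))) ∧
    ∀ σ : ZMod 8,
      (∑ᶠ β : ↥(Asub Ibar), iPow (Qq (β : A₂))) =
        (Real.sqrt 2 : ℂ) ^ g *
          Complex.exp ((Real.pi : ℂ) * Complex.I * (σ.val : ℂ) / 4) →
      ((2 * m : ℕ) : ZMod 8) =
        σ + (g : ZMod 8) - 2 * ((Qq (pr ⟨(2 : ℂ) • x, hx2⟩)).val : ZMod 8) := by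
  have hc2 : ∀ y : A₂, y + y = 0 := fun y => by
    have h := add_smul (1 : ZMod 2) 1 y
    rw [one_smul] at h
    rw [← h, show (1 + 1 : ZMod 2) = 0 from rfl, zero_smul]
  have hneg : ∀ y : A₂, -y = y := fun y => neg_eq_of_add_eq_zero_left (hc2 y)
  have hq0 : q 0 = 0 := by
    have h := hq 0 0
    simp only [add_zero, map_zero, LinearMap.zero_apply] at h
    have h0 : emb2 0 = 0 := rfl
    rw [h0, add_zero] at h
    exact left_eq_add.mp h
  let a : Γ → ℂ := fun γ => iPow (q (pr γ))
  have ha : ∀ γ, a γ = iPow (q (pr γ)) := fun _ => rfl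
  obtain ⟨D, h1, h2, h3, h4, h5, h6⟩ :=
    lat_exists Γ hrank hspan Imul hImul hHint hunimod
  have L : LatData Γ D a :=
    { countable := h1
      fd := h2
      bdd := h3
      vol := h4
      cover := h5
      summ := h6
      a_pm := by
        intro γ
        have hee : e (pr γ) (pr γ) = 0 := by
          have := he γ γ 0 (by rw [Hform_self]; simp)
          simpa using this
        have h := hq (pr γ) (pr γ)
        have h0 : emb2 0 = 0 := rfl
        rw [hc2, hq0, hee, h0, add_zero] at h
        apply mul_self_eq_one_iff.mp
        rw [ha, ← iPow_add, ← h, iPow_zero']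
      a_sub := by
        intro γ δ
        obtain ⟨k, n, hn⟩ := hHint δ γ
        have him : (Hform g δ γ).im = (n : ℝ) := by rw [hn]; simp
        have hpr2 : pr (γ - δ) = pr δ + pr γ := by
          rw [map_sub, sub_eq_add_neg, hneg, add_comm]
        have hH : Hform g γ δ = (k : ℂ) - (n : ℂ) * Complex.I := by
          rw [← Hform_conj, hn]; simp; ring
        rw [ha, hpr2, hq, he δ γ n him, emb2_int, iPow_add, iPow_add, iPow_int, hn, hH, ha, ha]
        rw [mul_comm (iPow (q (pr δ)))]
        congr 2
        push_cast
        ring }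
  have hh : ∀ (γ : Γ) w, nf θ (w + γ) = chi a γ w * nf θ w := by
    intro γ w
    rw [nf, nf, hθfe, chi, ha]
    have e1 : Complex.exp ((Real.pi : ℂ) *
            Hform g (γ : Fin g → ℂ) (w + (2 : ℂ)⁻¹ • (γ : Fin g → ℂ))) *
        Complex.exp (-(Real.pi / 2 : ℂ) * Hform g (w + γ) (w + γ)) =
        Complex.exp (Real.pi / 2 * (Hform g γ w - Hform g w γ)) *
        Complex.exp (-(Real.pi / 2 : ℂ) * Hform g w w) := by
      rw [← Complex.exp_add, ← Complex.exp_add]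
      congr 1
      simp only [Hform_add_left, Hform_add_right, Hform_smul_right]
      ring
    linear_combination iPow (q (pr γ)) * θ w * e1
  have hI : ∀ γ : Γ, ∃ γ' : Γ, (γ' : Fin g → ℂ) = Complex.I • (γ : Fin g → ℂ) ∧ a γ' = a γ :=
    fun γ => ⟨Imul γ, hImul γ, by rw [ha, ha, ← hIbar, hqi]⟩
  have heig := L.eigen hθd hθne hh hI
  have hGen : ∀ γ : Γ, a γ * Complex.exp (-(Real.pi * Complex.I / 2) * nsq (γ : Fin g → ℂ)) =
      iPow (Qq (pr γ + Ibar (pr γ))) := by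
    intro γ
    obtain ⟨k, n, hn⟩ := hHint γ γ
    have hre : (Hform g γ γ).re = (k : ℝ) := by rw [hn]; simp
    have hk : (nsq (γ : Fin g → ℂ) : ℂ) = (k : ℂ) := by
      rw [nsq_eq, hre]; simp
    rw [hQq, hQ γ k hre, hk, sub_eq_add_neg, ← Int.cast_neg, iPow_add, iPow_int, ha]
    congr 2
    push_cast
    ring
  let s : Γ →+ ↥(Asub Ibar) := ((eps Ibar).rangeRestrict.toAddMonoidHom).comp pr
  have hsv : ∀ γ, (s γ : A₂) = pr γ + Ibar (pr γ) := fun γ => rfl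
  have hs : Function.Surjective s := by
    rintro ⟨y, ⟨y', rfl⟩⟩
    obtain ⟨γ, rfl⟩ := hpr y'
    exact ⟨γ, rfl⟩
  let J : Γ →+ Γ := Imul - AddMonoidHom.id Γ
  have hJ : ∀ δ : Γ, (J δ : Fin g → ℂ) = (Complex.I - 1) • (δ : Fin g → ℂ) := by
    intro δ
    change ((Imul δ - δ : Γ) : Fin g → ℂ) = _
    rw [AddSubgroup.coe_sub, hImul, sub_smul, one_smul]
  have hk : ∀ γ, s γ = 0 ↔ ∃ δ, γ = J δ := by
    intro γ
    rw [← Subtype.coe_inj, hsv, hIbar, ← map_add]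
    change pr (γ + Imul γ) = 0 ↔ _
    rw [hker]
    have hI2 := Complex.I_sq
    constructor
    · rintro ⟨η, hη⟩
      refine ⟨-η, Subtype.ext ?_⟩
      have h7 := congrArg (fun t : Γ => (t : Fin g → ℂ)) hη
      simp only [AddSubgroup.coe_add, hImul] at h7
      rw [hJ]
      ext j
      have h8 := congrFun h7 j
      simp at h8 ⊢
      linear_combination (1 - Complex.I) / 2 * h8 + (γ : Fin g → ℂ) j / 2 * hI2
    · rintro ⟨δ, rfl⟩
      refine ⟨-δ, Subtype.ext ?_⟩
      simp only [AddSubgroup.coe_add, hImul, hJ]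
      ext j
      simp
      linear_combination (δ : Fin g → ℂ) j * hI2
  have hfirst : Complex.I ^ m * iPow (Qq (pr ⟨(2 : ℂ) • x, hx2⟩)) =
      (1 - Complex.I) ^ (-(g : ℤ)) * ∑ᶠ β : ↥(Asub Ibar), iPow (Qq (β : A₂)) := by
    have : Fintype ↥(Asub Ibar) := Fintype.ofFinite _
    rw [finsum_eq_sum_of_fintype]
    have hlef := L.lefschetz s hs J hJ hk (fun b => iPow (Qq (b : A₂))) hGen
    rw [← hlef]
    let γ0 : Γ := ⟨Complex.I • x - x, hix⟩
    have hγ0 : (γ0 : Fin g → ℂ) = Complex.I • x - x := rfl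
    have hdH := (contDiff_Hform (g := g) (γ0 : Fin g → ℂ) (n := 1)).differentiable (by simp)
    have hoc := order_compare (θ := θ) (e := fun z => iPow (q (pr γ0)) *
          Complex.exp ((Real.pi : ℂ) *
            Hform g (γ0 : Fin g → ℂ) (x + Complex.I • z + (2 : ℂ)⁻¹ • (γ0 : Fin g → ℂ)))) hθd
      (by
        have hd2 : Differentiable ℂ fun z : Fin g → ℂ => Hform g (γ0 : Fin g → ℂ)
            (x + Complex.I • z + (2 : ℂ)⁻¹ • (γ0 : Fin g → ℂ)) :=
          hdH.comp (f := fun z : Fin g → ℂ => x + Complex.I • z + (2 : ℂ)⁻¹ • (γ0 : Fin g → ℂ))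
            (by fun_prop)
        fun_prop) x (∫ w in D, KK a (Complex.I • w) w)
      (by
        intro z
        rw [← hθfe γ0, ← heig]
        congr 1
        rw [hγ0, smul_add]
        abel) m hm hmmin
    rw [← hoc, mul_comm]
    congr 1
    have hα : pr ⟨(2 : ℂ) • x, hx2⟩ = pr γ0 + Ibar (pr γ0) := by
      rw [hIbar, ← map_add, ← hneg (pr (γ0 + Imul γ0)), ← map_neg]
      congr 1
      apply Subtype.ext
      simp only [AddSubgroup.coe_neg, AddSubgroup.coe_add, hImul, hγ0]
      ext j
      simp
      linear_combination x j * Complex.I_sq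
    rw [hα, ← hGen, ha]
    congr 2
    have hx0 : x + Complex.I • (0 : Fin g → ℂ) + (2 : ℂ)⁻¹ • (γ0 : Fin g → ℂ) =
        (-(Complex.I / 2)) • (γ0 : Fin g → ℂ) := by
      rw [hγ0]
      ext j
      simp
      linear_combination x j / 2 * Complex.I_sq
    rw [hx0, Hform_smul_right, Hform_self]
    ring
  exact ⟨hfirst, fun σ hσ => brown_congr m g _ _ hfirst σ hσ⟩
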